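/- arXiv:2308.10749 — 4 statements merged into one kernel-verified Lean document; each statement's English description precedes it below -/
import Mathlib

section
/- For all positive integers r and k, and every coloring C : ℚ₊ → {1,…,r} of the positive rationals, there exist x₁,…,x_k ∈ ℚ₊ (not necessarily distinct) such that the set {Σ_{i∈I} x_i : I a nonempty subset of [k]} ∪ {Π_{j∈J} x_j : J a nonempty subset of [k]} is monochromatic under C (all its elements receive the same color). -/
namespace HindQ

inductive Reach {α : Type} (n : ℕ) (v : ℕ → α → ℚ) : ℕ → ℚ → Prop
  | zero (t : ℕ) : Reach n v t 0
  | add (t u : ℕ) (a : α) (w : ℚ) : t ≤ u → u < n → Reach n v (u + 1) w →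
      Reach n v t (v u a + w)

def consN (a : ℕ) (d : ℕ → ℕ) : ℕ → ℕ
  | 0 => a
  | k + 1 => d k

theorem Reach.mono {α : Type} {n : ℕ} {v : ℕ → α → ℚ} {t : ℕ} {w : ℚ}
    (h : Reach n v t w) {t' : ℕ} (ht : t' ≤ t) : Reach n v t' w := by
  cases h with
  | zero => exact Reach.zero _
  | add _ u a w h1 h2 h3 => exact Reach.add _ u a w (ht.trans h1) h2 h3

theorem Reach.shift {α β : Type} {n : ℕ} {v : ℕ → α → ℚ} {v' : ℕ → β → ℚ} (g : α → β)
    (hv : ∀ u a, v (u + 1) a = v' u (g a)) {t : ℕ} {w : ℚ}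
    (h : Reach (n + 1) v t w) : ∀ t', t = t' + 1 → Reach n v' t' w := by
  induction h with
  | zero => intro t' _; exact Reach.zero _
  | add t u a w h1 h2 _ ih =>
    intro t' ht
    obtain ⟨u', rfl⟩ : ∃ u', u = u' + 1 := ⟨u - 1, by omega⟩
    rw [hv]
    exact Reach.add _ _ _ _ (by omega) (by omega) (ih _ rfl)

open Combinatorics in
theorem stage (n : ℕ) : ∀ (α κ : Type) [Finite α] [Finite κ], ∃ M : ℕ,
    ∀ (s : ℕ → (ℕ → ℕ) → α → ℚ) (F : ℕ → (ℕ → ℕ) → ℚ → κ),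
      (∀ t d a, 0 ≤ s t d a) →
      (∀ t d d', (∀ u < t, d u = d' u) → s t d = s t d') →
      (∀ t d d', (∀ u < t, d u = d' u) → F t d = F t d') →
      ∃ (d : ℕ → ℕ) (X : ℚ), 0 < X ∧ (∀ t, 1 ≤ d t ∧ d t ≤ M) ∧
        ∀ t w, Reach n (fun u a => (d u : ℚ) * s u d a) t w → F t d (X + w) = F t d X := by
  induction n with
  | zero =>
    intro α κ _ _
    refine ⟨1, fun s F _ _ _ => ⟨fun _ => 1, 1, by norm_num, by simp, ?_⟩⟩
    intro t w h
    cases h with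
    | zero => simp
    | add _ u a w h1 h2 h3 => omega
  | succ n ih =>
    intro α κ _ _
    obtain ⟨ι, hι, hHJ⟩ := Line.exists_mono_in_high_dimension (Option α) κ
    obtain ⟨M', hM'⟩ := ih (Fin (Fintype.card ι + 1) × α)
      (Fin (Fintype.card ι + 1) × (ι → Option α) × Option α → κ × κ)
    refine ⟨max (Fintype.card ι) M', ?_⟩
    intro s F hs hsd hFd
    set sO : Option α → ℚ := fun b => b.elim 0 (s 0 (fun _ => 0)) with hsO
    have hsO0 : ∀ b, 0 ≤ sO b := by
      intro b
      cases b with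
      | none => simp [hsO]
      | some a => simpa [hsO] using hs _ _ _
    set o : (ι → Option α) → ℚ := fun w => ∑ i, sO (w i) with ho
    obtain ⟨d', Y, hY, hd', hR⟩ := hM'
      (fun t d p => s (t + 1) (consN p.1 d) p.2)
      (fun t d Y p => (F (t + 1) (consN p.1 d) (Y + o p.2.1),
        F 0 (fun _ => 0) (Y + o p.2.1 + (p.1 : ℕ) * sO p.2.2)))
      (fun t d a => hs _ _ _)
      (by
        intro t d e h
        funext p
        rw [hsd (t + 1) (consN p.1 d) (consN p.1 e)]
        intro u hu
        cases u with
        | zero => rfl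
        | succ u => exact h u (by omega))
      (by
        intro t d e h
        funext Y p
        rw [hFd (t + 1) (consN p.1 d) (consN p.1 e)]
        intro u hu
        cases u with
        | zero => rfl
        | succ u => exact h u (by omega))
    obtain ⟨l, c, hl⟩ := hHJ (fun w => F 0 (fun _ => 0) (Y + o w))
    classical
    set d0 : ℕ := (Finset.univ.filter (fun i => l.idxFun i = none)).card with hd0
    have hd0pos : 1 ≤ d0 := by
      obtain ⟨i, hi⟩ := l.proper
      exact Finset.card_pos.2 ⟨i, by simp [hi]⟩
    have hd0le : d0 ≤ Fintype.card ι := Finset.card_le_univ _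
    have hline : ∀ b, o (l b) = o (l none) + d0 * sO b := by
      intro b
      simp only [ho]
      have h1 : ∀ i, sO (l b i) = sO (l none i) + if l.idxFun i = none then sO b else 0 := by
        intro i
        rw [Line.apply_def, Line.apply_def]
        cases h : l.idxFun i with
        | none => simp [h, hsO]
        | some a => simp [h]
      rw [Finset.sum_congr rfl (fun i _ => h1 i), Finset.sum_add_distrib, ← Finset.sum_filter,
        Finset.sum_const, nsmul_eq_mul]
    set w0 := l none with hw0
    let p0 : Fin (Fintype.card ι + 1) := ⟨d0, by omega⟩
    have hF0 : ∀ d, F 0 d = F 0 (fun _ => 0) := fun d => hFd 0 _ _ (by simp)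
    have hs0 : ∀ d, s 0 d = s 0 (fun _ => 0) := fun d => hsd 0 _ _ (by simp)
    have hkey : ∀ b, F 0 (fun _ => 0) (Y + o w0 + d0 * sO b) = F 0 (fun _ => 0) (Y + o w0) := by
      intro b
      have h1 := hl b
      have h2 := hl none
      simp only at h1 h2
      rw [add_assoc, ← hline, h1, h2]
    refine ⟨consN d0 d', Y + o w0, ?_, ?_, ?_⟩
    · have : 0 ≤ o w0 := Finset.sum_nonneg (fun i _ => hsO0 _)
      linarith
    · intro t
      cases t with
      | zero => exact ⟨hd0pos, hd0le.trans (le_max_left _ _)⟩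
      | succ t => exact ⟨(hd' t).1, (hd' t).2.trans (le_max_right _ _)⟩
    · have hsh : ∀ t w, Reach (n + 1) (fun u a => (consN d0 d' u : ℚ) * s u (consN d0 d') a)
          (t + 1) w → Reach n (fun u (a : Fin (Fintype.card ι + 1) × α) =>
            (d' u : ℚ) * s (u + 1) (consN a.1 d') a.2) t w := by
        intro t w h
        exact Reach.shift (fun a => (p0, a)) (fun u a => rfl) h t rfl
      have h0 : ∀ b w, Reach (n + 1) (fun u a => (consN d0 d' u : ℚ) * s u (consN d0 d') a)
          1 w → F 0 (fun _ => 0) (Y + o w0 + (d0 * sO b + w)) = F 0 (fun _ => 0) (Y + o w0) := by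
        intro b w h
        have h1 := congrFun (hR 0 w (hsh 0 w h)) (p0, w0, b)
        have h2 := congrArg Prod.snd h1
        simp only [p0] at h2
        rw [hkey b] at h2
        rw [← h2]
        congr 1
        ring
      intro t w h
      cases t with
      | zero =>
        rw [hF0]
        cases h with
        | zero => simp
        | add _ u a w h1 h2 h3 =>
          cases u with
          | zero =>
            have := h0 (some a) w h3
            simpa [hsO, hs0 (consN d0 d'), consN] using this
          | succ u =>
            have := h0 none _ (Reach.add 1 (u + 1) a w (by omega) h2 h3)
            simpa [hsO] using this
      | succ t =>
        have h1 := congrFun (hR t w (hsh t w h)) (p0, w0, none)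
        have h2 := congrArg Prod.fst h1
        simp only [p0] at h2
        rw [← h2]
        congr 1
        ring


inductive Sm (y : ℕ → ℚ) (D N : ℕ) : ℕ → ℚ → Prop
  | zero (m : ℕ) : Sm y D N m 0
  | add (m : ℕ) (B : Finset ℕ) (c : ℕ) (z : ℚ) (m' : ℕ) : B.Nonempty →
      (∀ i ∈ B, m ≤ i ∧ i < m') → 1 ≤ c → c ≤ D → m' ≤ N →
      Sm y D N m' z → Sm y D N m ((c : ℚ) * ∏ i ∈ B, y i + z)

def sh (B : Finset ℕ) : Finset ℕ := (B.erase 0).image Nat.pred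

theorem mem_sh (B : Finset ℕ) (i : ℕ) : i ∈ sh B ↔ i + 1 ∈ B := by
  unfold sh
  simp only [Finset.mem_image, Finset.mem_erase]
  constructor
  · rintro ⟨j, ⟨h1, h2⟩, rfl⟩
    rwa [Nat.pred_eq_sub_one, Nat.sub_add_cancel (by omega)]
  · intro h
    exact ⟨i + 1, ⟨by omega, h⟩, rfl⟩

def consQ (X : ℚ) (y : ℕ → ℚ) : ℕ → ℚ
  | 0 => X
  | k + 1 => y k

theorem prod_sh_erase (X : ℚ) (y : ℕ → ℚ) (B : Finset ℕ) :
    ∏ i ∈ B.erase 0, consQ X y i = ∏ i ∈ sh B, y i := by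
  unfold sh
  rw [Finset.prod_image]
  · refine Finset.prod_congr rfl fun i hi => ?_
    obtain ⟨j, rfl⟩ : ∃ j, i = j + 1 := ⟨i - 1, by have := (Finset.mem_erase.1 hi).1; omega⟩
    rfl
  · intro i hi j hj h
    have h1 := (Finset.mem_erase.1 hi).1
    have h2 := (Finset.mem_erase.1 hj).1
    simp only [Nat.pred_eq_sub_one] at h
    omega

theorem prod_sh_zero (X : ℚ) (y : ℕ → ℚ) (B : Finset ℕ) (h : 0 ∈ B) :
    ∏ i ∈ B, consQ X y i = X * ∏ i ∈ sh B, y i := by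
  rw [← prod_sh_erase X y B, ← Finset.mul_prod_erase B _ h]
  rfl

theorem prod_sh_nz (X : ℚ) (y : ℕ → ℚ) (B : Finset ℕ) (h : 0 ∉ B) :
    ∏ i ∈ B, consQ X y i = ∏ i ∈ sh B, y i := by
  rw [← prod_sh_erase X y B, Finset.erase_eq_of_notMem h]

theorem sh_nonempty (B : Finset ℕ) (h : 0 ∉ B) (hB : B.Nonempty) : (sh B).Nonempty := by
  obtain ⟨i, hi⟩ := hB
  refine ⟨i - 1, ?_⟩
  rw [mem_sh]
  have : i ≠ 0 := by rintro rfl; exact h hi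
  rwa [Nat.sub_add_cancel (by omega)]

theorem Sm.unshift {X : ℚ} {y : ℕ → ℚ} {D N q : ℕ} {z : ℚ} (h : Sm (consQ X y) D (N + 1) q z) :
    ∀ m, q = m + 1 → Sm y D N m z := by
  induction h with
  | zero => intro m _; exact Sm.zero _
  | add q B c z m' hB h1 hc hc' hm _ ih =>
    intro m hq
    have h0 : 0 ∉ B := fun h => by have := h1 0 h; omega
    obtain ⟨i, hi⟩ := hB
    have := h1 i hi
    obtain ⟨m'', rfl⟩ : ∃ m'', m' = m'' + 1 := ⟨m' - 1, by omega⟩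
    rw [prod_sh_nz _ _ _ h0]
    refine Sm.add _ _ _ _ m'' (sh_nonempty B h0 ⟨i, hi⟩) ?_ hc hc' (by omega) (ih _ rfl)
    intro j hj
    have := h1 _ ((mem_sh _ _).1 hj)
    omega

theorem prod_d_le {d : ℕ → ℕ} {M N : ℕ} (hd : ∀ t, 1 ≤ d t ∧ d t ≤ M) (B : Finset ℕ)
    (hB : ∀ i ∈ B, i < N) : 1 ≤ ∏ i ∈ B, d i ∧ ∏ i ∈ B, d i ≤ M ^ N := by
  constructor
  · exact Nat.succ_le_of_lt (Finset.prod_pos (f := d) fun i _ => (hd i).1)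
  · calc ∏ i ∈ B, d i ≤ ∏ i ∈ B, M := Finset.prod_le_prod' fun i _ => (hd i).2
      _ = M ^ B.card := by simp
      _ ≤ M ^ N := by
        apply Nat.pow_le_pow_right
        · exact (hd 0).1.trans (hd 0).2
        · have : B ⊆ Finset.range N := fun i hi => Finset.mem_range.2 (hB i hi)
          simpa using Finset.card_le_card this

theorem Sm.scale {y : ℕ → ℚ} {d : ℕ → ℕ} {M D N m : ℕ} {z : ℚ} (hd : ∀ t, 1 ≤ d t ∧ d t ≤ M)
    (h : Sm (fun i => (d i : ℚ) * y i) D N m z) : Sm y (D * M ^ N) N m z := by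
  induction h with
  | zero => exact Sm.zero _
  | add q B c z m' hB h1 hc hc' hm _ ih =>
    have h2 := prod_d_le hd B (N := N) (fun i hi => (h1 i hi).2.trans_le hm)
    have := Sm.add q B (c * ∏ i ∈ B, d i) z m' hB h1 (Nat.mul_pos hc h2.1)
      (Nat.mul_le_mul hc' h2.2) hm ih
    convert this using 2
    rw [Finset.prod_mul_distrib]
    push_cast
    ring

abbrev Alp (D N : ℕ) : Type :=
  (Fin (D + 1) × ↥(Finset.range N).powerset) × (Fin (D + 1) × ↥(Finset.range N).powerset)

def pr (y : ℕ → ℚ) (d : ℕ → ℕ) (B : Finset ℕ) (u : ℕ) : ℚ :=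
  ∏ i ∈ B.filter (· < u), (d i : ℚ) * y i

def sval (y : ℕ → ℚ) (D N : ℕ) (u : ℕ) (d : ℕ → ℕ) (a : Alp D N) : ℚ :=
  ((a.1.1 : ℕ) : ℚ) * y u * pr y d a.1.2.1 u / (((a.2.1 : ℕ) : ℚ) * pr y d a.2.2.1 u)

theorem pr_congr (y : ℕ → ℚ) (B : Finset ℕ) (u : ℕ) (d d' : ℕ → ℕ)
    (h : ∀ v < u, d v = d' v) : pr y d B u = pr y d' B u := by
  unfold pr
  refine Finset.prod_congr rfl fun i hi => ?_
  rw [h i (Finset.mem_filter.1 hi).2]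

theorem pr_nonneg (y : ℕ → ℚ) (hy : ∀ i, 0 < y i) (B : Finset ℕ) (u : ℕ) (d : ℕ → ℕ) :
    0 ≤ pr y d B u :=
  Finset.prod_nonneg fun i _ => mul_nonneg (Nat.cast_nonneg _) (hy i).le

theorem pr_all (y : ℕ → ℚ) (B : Finset ℕ) (u : ℕ) (d : ℕ → ℕ) (h : ∀ i ∈ B, i < u) :
    pr y d B u = ∏ i ∈ B, (d i : ℚ) * y i := by
  unfold pr
  rw [Finset.filter_true_of_mem h]

theorem Sm.reach {y : ℕ → ℚ} {d : ℕ → ℕ} {D N m : ℕ} {z : ℚ}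
    (B2 : Finset ℕ) (hB2 : B2 ∈ (Finset.range N).powerset) (c2 : ℕ) (hc2 : c2 ≤ D)
    (h : Sm (fun i => (d i : ℚ) * y i) D N m z) : (∀ i ∈ B2, i < m) →
    Reach N (fun u a => (d u : ℚ) * sval y D N u d a) m
      (z / ((c2 : ℚ) * ∏ i ∈ B2, (d i : ℚ) * y i)) := by
  induction h with
  | zero => intro _; rw [zero_div]; exact Reach.zero _
  | add q B c z m' hB h1 hc hc' hm _ ih =>
    intro hB2'
    have hmax := B.max'_mem hB
    set u := B.max' hB with hu
    have hu1 := h1 u hmax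
    have ih' := ih (fun i hi => by have := hB2' i hi; omega)
    have hBN : B ∈ (Finset.range N).powerset := by
      rw [Finset.mem_powerset]
      intro i hi
      have := h1 i hi
      exact Finset.mem_range.2 (by omega)
    have key := Reach.add (v := fun u a => (d u : ℚ) * sval y D N u d a) (n := N) q u
      ((⟨c, by omega⟩, ⟨B, hBN⟩), (⟨c2, by omega⟩, ⟨B2, hB2⟩)) _ hu1.1 (by omega)
      (ih'.mono (by omega))
    convert key using 1
    rw [add_div]
    congr 1
    simp only [sval]
    rw [pr_all y B2 u d (fun i hi => by have := hB2' i hi; omega)]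
    have : pr y d B u = ∏ i ∈ B.erase u, (d i : ℚ) * y i := by
      unfold pr
      congr 1
      ext i
      simp only [Finset.mem_filter, Finset.mem_erase]
      constructor
      · rintro ⟨h1, h2⟩; exact ⟨h2.ne, h1⟩
      · rintro ⟨h1, h2⟩; exact ⟨h2, lt_of_le_of_ne (B.le_max' i h2) h1⟩
    rw [this, ← Finset.mul_prod_erase B _ hmax]
    ring

theorem claim {r : ℕ} (C : ℚ → Fin r) (N : ℕ) : ∀ D : ℕ, ∃ y : ℕ → ℚ, (∀ i, 0 < y i) ∧
    ∀ (B : Finset ℕ) (m' c : ℕ) (z : ℚ), B.Nonempty → (∀ i ∈ B, i < m') → m' ≤ N → 1 ≤ c → c ≤ D →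
      Sm y D N m' z → C ((c : ℚ) * ∏ i ∈ B, y i + z) = C ((c : ℚ) * ∏ i ∈ B, y i) := by
  induction N with
  | zero =>
    intro D
    refine ⟨fun _ => 1, fun _ => one_pos, ?_⟩
    intro B m' c z ⟨i, hi⟩ h hm
    have := h i hi
    omega
  | succ N IH =>
    intro D
    obtain ⟨M, hM⟩ := stage N (Alp D N) ((Fin (D + 1) × ↥(Finset.range N).powerset) → Fin r)
    obtain ⟨y, hy, hcl⟩ := IH (D * M ^ N)
    obtain ⟨d, X, hX, hd, hF⟩ := hM (sval y D N)
      (fun t d X p => C (((p.1 : ℕ) : ℚ) * pr y d p.2.1 t * X))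
      (by
        intro t d a
        have := pr_nonneg y hy a.1.2.1 t d
        have := pr_nonneg y hy a.2.2.1 t d
        have := (hy t).le
        unfold sval
        positivity)
      (by
        intro t d d' h
        funext a
        unfold sval
        rw [pr_congr y _ t d d' h, pr_congr y _ t d d' h])
      (by
        intro t d d' h
        funext X p
        rw [pr_congr y _ t d d' h])
    have hpos : ∀ i, 0 < (d i : ℚ) * y i := fun i =>
      mul_pos (by exact_mod_cast (hd i).1) (hy i)
    refine ⟨consQ X (fun i => (d i : ℚ) * y i), ?_, ?_⟩
    · intro i
      cases i with
      | zero => exact hX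
      | succ i => exact hpos i
    · intro B m' c z hB hBm hm hc hcD hS
      obtain ⟨i0, hi0⟩ := hB
      have := hBm i0 hi0
      obtain ⟨m, rfl⟩ : ∃ m, m' = m + 1 := ⟨m' - 1, by omega⟩
      have hS' := hS.unshift m rfl
      have hsh : ∀ i ∈ sh B, i < m := fun i hi => by
        have := hBm _ ((mem_sh _ _).1 hi)
        omega
      by_cases h0 : 0 ∈ B
      · rw [prod_sh_zero _ _ _ h0]
        have hBN : sh B ∈ (Finset.range N).powerset := by
          rw [Finset.mem_powerset]
          intro i hi
          have := hsh i hi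
          exact Finset.mem_range.2 (by omega)
        have h1 := hF m _ (hS'.reach (sh B) hBN c hcD hsh)
        have h2 := congrFun h1 (⟨c, by omega⟩, ⟨sh B, hBN⟩)
        simp only [pr_all y (sh B) m d hsh] at h2
        have hP : 0 < ∏ i ∈ sh B, (d i : ℚ) * y i := Finset.prod_pos fun i _ => hpos i
        have hcQ : (0 : ℚ) < c := by exact_mod_cast hc
        convert h2 using 2
        · field_simp
        · ring
      · rw [prod_sh_nz _ _ _ h0]
        have h2 := prod_d_le hd (sh B) (N := N) (fun i hi => by have := hsh i hi; omega)
        have h3 := hcl (sh B) m (c * ∏ i ∈ sh B, d i) z (sh_nonempty B h0 ⟨i0, hi0⟩) hsh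
          (by omega) (Nat.mul_pos hc h2.1) (Nat.mul_le_mul hcD h2.2) (hS'.scale hd)
        have h4 : ((c * ∏ i ∈ sh B, d i : ℕ) : ℚ) * ∏ i ∈ sh B, y i
            = (c : ℚ) * ∏ i ∈ sh B, (d i : ℚ) * y i := by
          rw [Finset.prod_mul_distrib]
          push_cast
          ring
        rw [h4] at h3
        exact h3


open Hindman Filter

theorem fp_words {s : Stream' (FreeMonoid ℕ)} {m : FreeMonoid ℕ} (h : FP s m) :
    ∀ n : ℕ, s = (fun i => FreeMonoid.of (n + i)) →
      (FreeMonoid.toList m ≠ [] ∧ (FreeMonoid.toList m).Pairwise (· < ·) ∧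
        ∀ i ∈ FreeMonoid.toList m, n ≤ i) := by
  have htail : ∀ (s : Stream' (FreeMonoid ℕ)) (n : ℕ), s = (fun i => FreeMonoid.of (n + i)) →
      s.tail = (fun i => FreeMonoid.of (n + 1 + i)) := by
    rintro s n rfl
    funext i
    change FreeMonoid.of (n + (i + 1)) = _
    congr 1
    omega
  induction h with
  | head' s =>
    rintro n rfl
    have : Stream'.head (fun i => FreeMonoid.of (n + i)) = FreeMonoid.of n := rfl
    rw [this]
    simp [FreeMonoid.toList_of]
  | tail' s m _ ih =>
    intro n hs
    obtain ⟨h1, h2, h3⟩ := ih (n + 1) (htail s n hs)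
    exact ⟨h1, h2, fun i hi => by have := h3 i hi; omega⟩
  | cons' s m _ ih =>
    intro n hs
    obtain ⟨h1, h2, h3⟩ := ih (n + 1) (htail s n hs)
    have : s.head = FreeMonoid.of n := by rw [hs]; rfl
    rw [this, FreeMonoid.toList_of_mul]
    refine ⟨by simp, List.pairwise_cons.2 ⟨fun i hi => h3 i hi, h2⟩, ?_⟩
    intro i hi
    rcases List.mem_cons.1 hi with rfl | hi
    · exact le_rfl
    · have := h3 i hi
      omega

theorem fp_finset (K : ℕ) : ∀ (b : Stream' (FreeMonoid ℕ)) (I : Finset ℕ), I.Nonempty →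
    (∀ i ∈ I, i < K) → ∃ m, FP b m ∧ ∀ g : FreeMonoid ℕ →* ℚ, g m = ∏ i ∈ I, g (b.get i) := by
  induction K with
  | zero =>
    intro b I ⟨i, hi⟩ h
    have := h i hi
    omega
  | succ K ih =>
    intro b I hI hK
    have hsh : ∀ i ∈ sh I, i < K := fun i hi => by
      have := hK _ ((mem_sh _ _).1 hi)
      omega
    have hc : ∀ g : FreeMonoid ℕ →* ℚ,
        (fun i => g (b.get i)) = consQ (g b.head) (fun i => g (b.tail.get i)) := by
      intro g
      funext i
      cases i <;> rfl
    by_cases h0 : 0 ∈ I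
    · by_cases hs : (sh I).Nonempty
      · obtain ⟨m, hm, hg⟩ := ih b.tail (sh I) hs hsh
        refine ⟨b.head * m, FP.cons' b m hm, fun g => ?_⟩
        have := prod_sh_zero (g b.head) (fun i => g (b.tail.get i)) I h0
        rw [← hc g] at this
        rw [this, map_mul, hg]
      · refine ⟨b.head, FP.head' b, fun g => ?_⟩
        have := prod_sh_zero (g b.head) (fun i => g (b.tail.get i)) I h0
        rw [← hc g, Finset.not_nonempty_iff_eq_empty.1 hs] at this
        rw [this]
        simp
    · obtain ⟨m, hm, hg⟩ := ih b.tail (sh I) (sh_nonempty I h0 hI) hsh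
      refine ⟨m, FP.tail' b m hm, fun g => ?_⟩
      have := prod_sh_nz (g b.head) (fun i => g (b.tail.get i)) I h0
      rw [← hc g] at this
      rw [this, hg]

theorem sum_sm {k : ℕ} {y : ℕ → ℚ} {N : ℕ} (Bl : Fin k → Finset ℕ) (hne : ∀ i, (Bl i).Nonempty)
    (hord : ∀ i j, i < j → ∀ p ∈ Bl i, ∀ q ∈ Bl j, p < q) (hN : ∀ i, ∀ p ∈ Bl i, p < N)
    (I : Finset (Fin k)) : ∀ m, (∀ i ∈ I, ∀ p ∈ Bl i, m ≤ p) →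
      Sm y 1 N m (∑ i ∈ I, ∏ j ∈ Bl i, y j) := by
  induction I using Finset.induction_on_min with
  | empty => intro m _; simpa using Sm.zero m
  | insert a s hs ih =>
    intro m hm
    have ha : a ∉ s := fun h => lt_irrefl _ (hs a h)
    rw [Finset.sum_insert ha]
    have hmax := (Bl a).max'_mem (hne a)
    have := Sm.add (y := y) (D := 1) (N := N) m (Bl a) 1 _ ((Bl a).max' (hne a) + 1) (hne a)
      (fun i hi => ⟨hm a (Finset.mem_insert_self _ _) i hi,
        Nat.lt_succ_of_le ((Bl a).le_max' i hi)⟩) le_rfl le_rfl (hN a _ hmax)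
      (ih _ (fun i hi p hp => hord a i (hs i hi) _ hmax p hp))
    simpa using this

theorem final (r k : ℕ) (C : ℚ → Fin r) :
    ∃ x : Fin k → ℚ, (∀ i, 0 < x i) ∧
      ∃ col : Fin r,
        ∀ I : Finset (Fin k), I.Nonempty →
          C (∑ i ∈ I, x i) = col ∧ C (∏ i ∈ I, x i) = col := by
  choose y hy hcl using fun N => claim C N 1
  have hf : ∀ w : FreeMonoid ℕ, ∃ c : Fin r,
      ∀ᶠ N in (hyperfilter ℕ : Filter ℕ), C (FreeMonoid.lift (y N) w) = c := by
    intro w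
    obtain ⟨c, hc⟩ := Ultrafilter.eq_pure_of_finite
      (Ultrafilter.map (fun N => C (FreeMonoid.lift (y N) w)) (hyperfilter ℕ))
    refine ⟨c, ?_⟩
    have : ({c} : Set (Fin r)) ∈ (pure c : Ultrafilter (Fin r)) := by
      rw [Ultrafilter.mem_pure]; rfl
    rw [← hc, Ultrafilter.mem_map] at this
    exact this
  choose f hf using hf
  let a : Stream' (FreeMonoid ℕ) := fun i => FreeMonoid.of (0 + i)
  obtain ⟨S, ⟨c, rfl⟩, b, hb⟩ := FP_partition_regular a
    (Set.range fun c : Fin r => {m | FP a m ∧ f m = c}) (Set.finite_range _)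
    (fun m hm => ⟨_, ⟨f m, rfl⟩, hm, rfl⟩)
  have hb' : ∀ m, FP b m → FP a m ∧ f m = c := fun m hm => hb hm
  have hmI : ∀ I : Finset (Fin k), ∃ m, I.Nonempty → FP b m ∧
      ∀ g : FreeMonoid ℕ →* ℚ, g m = ∏ i ∈ I, g (b.get i) := by
    intro I
    by_cases hI : I.Nonempty
    · obtain ⟨m, h1, h2⟩ := fp_finset k b (I.map Fin.valEmbedding) (hI.map)
        (fun i hi => by
          obtain ⟨j, _, rfl⟩ := Finset.mem_map.1 hi
          exact j.2)
      refine ⟨m, fun _ => ⟨h1, fun g => ?_⟩⟩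
      rw [h2 g, Finset.prod_map]
      rfl
    · exact ⟨1, fun h => absurd h hI⟩
  choose w hw using hmI
  let Bl : Fin k → Finset ℕ := fun i => (FreeMonoid.toList (b.get i)).toFinset
  have hword : ∀ i : Fin k, _ := fun i =>
    fp_words (hb' _ (FP.singleton b i)).1 0 rfl
  have hne : ∀ i, (Bl i).Nonempty := fun i => by
    have := (hword i).1
    exact List.toFinset_nonempty_iff _ |>.2 this
  have hord : ∀ i j, i < j → ∀ p ∈ Bl i, ∀ q ∈ Bl j, p < q := by
    intro i j hij p hp q hq
    have := (fp_words (hb' _ (FP.mul_two b i j hij)).1 0 rfl).2.1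
    rw [FreeMonoid.toList_mul, List.pairwise_append] at this
    exact this.2.2 p (List.mem_toFinset.1 hp) q (List.mem_toFinset.1 hq)
  have hev1 : ∀ᶠ N in (hyperfilter ℕ : Filter ℕ), ∀ I : Finset (Fin k),
      C (FreeMonoid.lift (y N) (w I)) = f (w I) := eventually_all.2 fun I => hf (w I)
  have hev2 : ∀ᶠ N in (hyperfilter ℕ : Filter ℕ), (Finset.univ.biUnion Bl).sup id < N :=
    Nat.hyperfilter_le_atTop (eventually_gt_atTop _)
  obtain ⟨N, h1, h2⟩ := (hev1.and hev2).exists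
  have hN : ∀ i, ∀ p ∈ Bl i, p < N := fun i p hp =>
    lt_of_le_of_lt (Finset.le_sup (f := id)
      (Finset.mem_biUnion.2 ⟨i, Finset.mem_univ _, hp⟩)) h2
  have hx : ∀ i : Fin k, FreeMonoid.lift (y N) (b.get i) = ∏ j ∈ Bl i, y N j := by
    intro i
    rw [FreeMonoid.lift_apply, List.prod_toFinset]
    exact (hword i).2.1.imp (fun h => h.ne)
  have hprod : ∀ I : Finset (Fin k), I.Nonempty → C (∏ i ∈ I, ∏ j ∈ Bl i, y N j) = c := by
    intro I hI
    have h3 := h1 I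
    rw [(hb' _ (hw I hI).1).2, (hw I hI).2] at h3
    rw [← h3]
    congr 1
    exact Finset.prod_congr rfl fun i _ => (hx i).symm
  refine ⟨fun i => ∏ j ∈ Bl i, y N j, fun i => Finset.prod_pos fun j _ => hy N j, c, ?_⟩
  intro I hI
  refine ⟨?_, hprod I hI⟩
  set a0 := I.min' hI with ha0
  have hmem : a0 ∈ I := I.min'_mem hI
  rw [← Finset.add_sum_erase I _ hmem]
  have hmax := (Bl a0).max'_mem (hne a0)
  have h4 := hcl N (Bl a0) ((Bl a0).max' (hne a0) + 1) 1 _ (hne a0)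
    (fun i hi => Nat.lt_succ_of_le ((Bl a0).le_max' i hi)) (hN a0 _ hmax) le_rfl le_rfl
    (sum_sm Bl hne hord hN (I.erase a0) _ (fun i hi p hp => hord a0 i
      (lt_of_le_of_ne (I.min'_le i (Finset.mem_of_mem_erase hi)) (Finset.ne_of_mem_erase hi).symm)
      _ hmax p hp))
  have h5 := hprod {a0} ⟨a0, by simp⟩
  simp only [Nat.cast_one, one_mul, Finset.prod_singleton] at h4 h5
  exact h4.trans h5

end HindQ

/-- **Hindman's theorem over the rationals** (Alweiss).
For all positive integers `r` and `k`, and every `r`-coloring `C` of the positive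
rationals, there exist positive rationals `x 1, …, x k` (not necessarily distinct)
such that all nonempty-subset sums and all nonempty-subset products of the `x i`
receive the same color. -/
theorem hindman_over_rationals (r k : ℕ) (hr : 0 < r) (hk : 0 < k)
    (C : ℚ → Fin r) :
    ∃ x : Fin k → ℚ, (∀ i, 0 < x i) ∧
      ∃ col : Fin r,
        ∀ I : Finset (Fin k), I.Nonempty →
          C (∑ i ∈ I, x i) = col ∧ C (∏ i ∈ I, x i) = col := by
  exact HindQ.final r k C
end

section
/- For all positive integers r and k, and every coloring C : ℚ₊ → {1,…,r} of the positive rationals, there exist x₁,…,x_k ∈ ℚ₊ (not necessarily distinct) such that the set {Σ_{j=1}^ℓ Π_{i∈I_j} x_i : ℓ ≥ 1 and I₁,…,I_ℓ nonempty pairwise disjoint subsets of [k]} is monochromatic under C. -/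
lemma pet_induction {A : Type*} (w : A → ℕ → ℕ) (Q : A → Prop)
    (hstep : ∀ a, (∀ a', (∃ d, w a' d < w a d ∧ ∀ e > d, w a' e ≤ w a e) → Q a') → Q a)
    (a : A) (n : ℕ) (hn : ∀ e ≥ n, w a e = 0) : Q a := by
  have key : ∀ n, ∀ a, (∀ a', (∃ d ≥ n, w a' d < w a d ∧ ∀ e > d, w a' e ≤ w a e) → Q a') → Q a := by
    intro n
    induction n with
    | zero =>
      intro a h
      apply hstep
      rintro a' ⟨d, h1, h2⟩
      exact h a' ⟨d, Nat.zero_le _, h1, h2⟩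
    | succ n ih =>
      intro a h
      have h3 : ∀ m, ∀ a'', (∀ e ≥ n+1, w a'' e ≤ w a e) → w a'' n = m → Q a'' := by
        intro m
        induction m using Nat.strong_induction_on with
        | _ m ihm =>
          intro a'' h4 h5
          apply ih
          rintro a' ⟨d, hd, h6, h7⟩
          rcases Nat.lt_or_ge n d with hlt | hge
          · apply h
            exact ⟨d, hlt, lt_of_lt_of_le h6 (h4 d hlt), fun e he =>
              (h7 e he).trans (h4 e (by omega))⟩
          · have : d = n := by omega
            subst this
            exact ihm _ (h5 ▸ h6) a' (fun e he => (h7 e he).trans (h4 e he)) rfl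
      exact h3 _ a (fun e _ => le_rfl) rfl
  apply key n a
  rintro a' ⟨d, hd, h1, _⟩
  rw [hn d hd] at h1
  omega

open Polynomial in
def PVWProp {R : Type} [CommRing R] (A : Finset R[X]) : Prop :=
  ∀ (α : Type) [Finite α], ∃ F : Finset R, ∃ N : ℕ, ∀ C : R → α,
    ∃ a ∈ F, ∃ d : ℕ, 1 ≤ d ∧ d ≤ N ∧ ∀ p ∈ A, C (a + p.eval (d:R)) = C a

open Polynomial in
noncomputable def petDeriv {R : Type} [CommRing R] (q p : R[X]) (d : ℕ) : R[X] :=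
  taylor (d:R) p - C (p.eval (d:R)) - q

open Polynomial Classical in
/-- colour focusing step -/
lemma pvw_focus {R : Type} [CommRing R] (A : Finset R[X]) (q : R[X])
    (hA0 : ∀ p ∈ A, p.eval 0 = 0)
    (hA : ∀ M : ℕ, PVWProp (((A ×ˢ Finset.range (M+1)).image
      (fun t => petDeriv q t.1 t.2)).erase 0)) : PVWProp A := by
  intro α _
  have foc : ∀ s : ℕ, ∃ F : Finset R, ∃ N : ℕ, ∀ C : R → α,
      (∃ a ∈ F, ∃ d : ℕ, 1 ≤ d ∧ d ≤ N ∧ ∀ p ∈ A, C (a + p.eval (d:R)) = C a) ∨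
      ∃ a ∈ F, ∃ K : Finset α, K.card = s ∧ C a ∉ K ∧ ∀ k ∈ K, ∃ d : ℕ, 1 ≤ d ∧ d ≤ N ∧
        ∀ p ∈ A, C (a + p.eval (d:R)) = k := by
    intro s
    induction s with
    | zero =>
      refine ⟨{0}, 1, fun C => Or.inr ⟨0, by simp, ∅, by simp⟩⟩
    | succ s ih =>
      obtain ⟨F, N, hF⟩ := ih
      let G : Finset R := ((F ×ˢ A ×ˢ Finset.range (N+1)).image
        (fun t => t.1 + t.2.1.eval (t.2.2:R)))
      obtain ⟨F', N', hF'⟩ := hA N (G → α)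
      refine ⟨((F' ×ˢ F).image fun t => t.1 + t.2) ∪
        ((F' ×ˢ F ×ˢ Finset.range (N'+1)).image fun t => t.1 + t.2.1 - q.eval (t.2.2:R)),
        N + N', fun C => ?_⟩
      obtain ⟨b, hb, e, he1, heN, hbe⟩ := hF' (fun x y => C (x + y.1))
      have hbe' : ∀ p ∈ A, ∀ d ≤ N, ∀ a ∈ F,
          C (b + a - q.eval (e:R) + p.eval ((d + e : ℕ):R)) = C (b + a + p.eval (d:R)) := by
        intro p hp d hd a ha
        have hG : a + p.eval (d:R) ∈ G := by
          refine Finset.mem_image.2 ⟨(a, p, d), ?_, rfl⟩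
          simp [ha, hp]; omega
        have hev : (petDeriv q p d).eval (e:R) = p.eval ((d+e:ℕ):R) - p.eval (d:R) - q.eval (e:R) := by
          simp [petDeriv, taylor_eval, add_comm]
        by_cases h0 : petDeriv q p d = 0
        · rw [h0] at hev
          congr 1
          simp only [eval_zero] at hev
          linear_combination -hev
        · have := hbe (petDeriv q p d) (Finset.mem_erase.2 ⟨h0, Finset.mem_image.2
            ⟨(p, d), by simp [hp]; omega, rfl⟩⟩)
          have := congrFun this ⟨_, hG⟩
          simp only [hev] at this
          rw [add_assoc b a, ← this]
          congr 1
          ring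
      rcases hF (fun y => C (b + y)) with ⟨a, ha, d, hd1, hdN, had⟩ | ⟨a, ha, K, hKs, haK, hK⟩
      · left
        refine ⟨b + a, Finset.mem_union_left _ (Finset.mem_image.2 ⟨(b, a), by simp [ha, hb], rfl⟩),
          d, hd1, by omega, fun p hp => ?_⟩
        rw [add_assoc]; exact had p hp
      · have hmem : b + a - q.eval (e:R) ∈ ((F' ×ˢ F).image fun t => t.1 + t.2) ∪
            ((F' ×ˢ F ×ˢ Finset.range (N'+1)).image fun t => t.1 + t.2.1 - q.eval (t.2.2:R)) := by
          refine Finset.mem_union_right _ (Finset.mem_image.2 ⟨(b, a, e), ?_, rfl⟩)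
          simp [ha, hb]; omega
        have hK' : ∀ k ∈ insert (C (b+a)) K, ∃ d : ℕ, 1 ≤ d ∧ d ≤ N + N' ∧
            ∀ p ∈ A, C (b + a - q.eval (e:R) + p.eval (d:R)) = k := by
          intro k hk
          rcases Finset.mem_insert.1 hk with rfl | hk
          · refine ⟨e, he1, by omega, fun p hp => ?_⟩
            have := hbe' p hp 0 (Nat.zero_le _) a ha
            simpa [hA0 p hp] using this
          · obtain ⟨d, hd1, hdN, hd⟩ := hK k hk
            refine ⟨d + e, by omega, by omega, fun p hp => ?_⟩
            rw [hbe' p hp d hdN a ha, ← hd p hp, add_assoc]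
        by_cases hc : C (b + a - q.eval (e:R)) ∈ insert (C (b+a)) K
        · left
          obtain ⟨d, h1, h2, h3⟩ := hK' _ hc
          exact ⟨_, hmem, d, h1, h2, h3⟩
        · right
          exact ⟨_, hmem, _, by rw [Finset.card_insert_of_notMem haK, hKs], hc, hK'⟩
  have := Fintype.ofFinite α
  obtain ⟨F, N, hF⟩ := foc (Fintype.card α + 1)
  refine ⟨F, N, fun C => ?_⟩
  rcases hF C with h | ⟨a, _, K, hK, _⟩
  · exact h
  · have := K.card_le_univ
    omega

open Polynomial Classical in
noncomputable def petWeight {R : Type} [CommRing R] (A : Finset R[X]) (D : ℕ) : ℕ :=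
  ((A.filter (fun p => p.natDegree = D)).image leadingCoeff).card

open Polynomial in
theorem pvw {R : Type} [CommRing R] (A : Finset R[X]) (hA : ∀ p ∈ A, p.eval 0 = 0) :
    PVWProp A := by
  classical
  have main : ∀ A : Finset R[X], (∀ p ∈ A, p ≠ 0 ∧ p.eval 0 = 0) → PVWProp A := by
    intro A
    refine pet_induction (petWeight) (fun A => (∀ p ∈ A, p ≠ 0 ∧ p.eval 0 = 0) → PVWProp A)
      ?_ A (A.sup natDegree + 1) ?_
    · intro A ih hA
      rcases A.eq_empty_or_nonempty with rfl | hne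
      · intro α _
        exact ⟨{0}, 1, fun C => ⟨0, by simp, 1, le_rfl, le_rfl, by simp⟩⟩
      obtain ⟨q, hq, hmin⟩ := A.exists_min_image natDegree hne
      refine pvw_focus A q (fun p hp => (hA p hp).2) fun M => ?_
      have hdeg : ∀ p ∈ A, 0 < p.natDegree := by
        intro p hp
        rcases Nat.eq_zero_or_pos p.natDegree with h | h
        · obtain ⟨c, rfl⟩ := natDegree_eq_zero.1 h
          have := hA _ hp
          simp at this
        · exact h
      have hcoef : ∀ p ∈ A, ∀ d : ℕ, ∀ D, q.natDegree ≤ D → p.natDegree ≤ D →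
          (petDeriv q p d).coeff D = p.coeff D - q.coeff D := by
        intro p hp d D hD hpD
        have h0 : 0 < D := lt_of_lt_of_le (hdeg q hq) hD
        simp only [petDeriv, coeff_sub, coeff_C, h0.ne', if_false, sub_zero]
        congr 1
        rcases hpD.eq_or_lt with h | h
        · rw [← h, coeff_taylor_natDegree]; rfl
        · rw [coeff_eq_zero_of_natDegree_lt (by rwa [natDegree_taylor]),
            coeff_eq_zero_of_natDegree_lt h]
      have hdegle : ∀ p ∈ A, ∀ d : ℕ, (petDeriv q p d).natDegree ≤ p.natDegree := by
        intro p hp d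
        rw [natDegree_le_iff_coeff_eq_zero]
        intro D hD
        rw [hcoef p hp d D ((hmin p hp).trans hD.le) hD.le, coeff_eq_zero_of_natDegree_lt hD,
          coeff_eq_zero_of_natDegree_lt (lt_of_le_of_lt (hmin p hp) hD), sub_zero]
      apply ih
      · refine ⟨q.natDegree, ?_, ?_⟩
        · -- strict decrease
          unfold petWeight
          have hsub : ((((A ×ˢ Finset.range (M+1)).image
              (fun t => petDeriv q t.1 t.2)).erase 0).filter
                (fun p => p.natDegree = q.natDegree)).image leadingCoeff ⊆
              ((((A.filter (fun p => p.natDegree = q.natDegree)).image leadingCoeff).erase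
                q.leadingCoeff).image (fun c => c - q.leadingCoeff)) := by
            intro c hc
            simp only [Finset.mem_image, Finset.mem_filter, Finset.mem_erase,
              Finset.mem_product, Prod.exists] at hc
            obtain ⟨u, ⟨⟨hu0, p, d, ⟨hp, hd⟩, rfl⟩, hu⟩, rfl⟩ := hc
            have hpq : p.natDegree = q.natDegree := by
              by_contra hne
              have hlt := lt_of_le_of_ne (hmin p hp) (Ne.symm hne)
              have h1 := hcoef p hp d p.natDegree hlt.le le_rfl
              rw [coeff_eq_zero_of_natDegree_lt hlt, sub_zero,
                coeff_eq_zero_of_natDegree_lt (by omega)] at h1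
              exact (hA p hp).1 (leadingCoeff_eq_zero.1 h1.symm)
            have h1 := hcoef p hp d q.natDegree le_rfl hpq.le
            have h2 : (petDeriv q p d).leadingCoeff = p.leadingCoeff - q.leadingCoeff := by
              rw [leadingCoeff, hu, h1, leadingCoeff, leadingCoeff, hpq]
            simp only [Finset.mem_image, Finset.mem_erase, Finset.mem_filter]
            refine ⟨p.leadingCoeff, ⟨?_, p, ⟨hp, hpq⟩, rfl⟩, h2.symm⟩
            intro h3
            rw [h3, sub_self, leadingCoeff_eq_zero] at h2
            exact hu0 h2
          refine lt_of_le_of_lt (Finset.card_le_card hsub) ?_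
          refine lt_of_le_of_lt Finset.card_image_le ?_
          apply Finset.card_erase_lt_of_mem
          exact Finset.mem_image_of_mem _ (by simp [hq])
        · intro D hD
          unfold petWeight
          apply Finset.card_le_card
          intro c hc
          simp only [Finset.mem_image, Finset.mem_filter, Finset.mem_erase,
              Finset.mem_product, Prod.exists] at hc ⊢
          obtain ⟨u, ⟨⟨hu0, p, d, ⟨hp, hd⟩, rfl⟩, hu⟩, rfl⟩ := hc
          have hle := hdegle p hp d
          have h1 := hcoef p hp d p.natDegree (by omega) le_rfl
          rw [coeff_eq_zero_of_natDegree_lt (show q.natDegree < p.natDegree by omega), sub_zero] at h1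
          have h2 : p.natDegree ≤ (petDeriv q p d).natDegree := by
            apply le_natDegree_of_ne_zero
            rw [h1]
            exact fun h => (hA p hp).1 (leadingCoeff_eq_zero.1 h)
          refine ⟨p, ⟨hp, by omega⟩, ?_⟩
          rw [leadingCoeff, ← h1, leadingCoeff, le_antisymm hle h2]
      · intro u hu
        simp only [Finset.mem_image, Finset.mem_erase,
              Finset.mem_product, Prod.exists] at hu
        obtain ⟨hu0, p, d, ⟨hp, hd⟩, rfl⟩ := hu
        refine ⟨hu0, ?_⟩
        simp [petDeriv, taylor_eval, (hA q hq).2]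
    · intro e he
      unfold petWeight
      rw [Finset.card_eq_zero, Finset.image_eq_empty, Finset.filter_eq_empty_iff]
      intro p hp h
      have := Finset.le_sup (f := natDegree) hp
      omega
  intro α _
  obtain ⟨F, N, h⟩ := main (A.erase 0) (fun p hp => by
    rw [Finset.mem_erase] at hp; exact ⟨hp.1, hA p hp.2⟩) α
  refine ⟨F, N, fun C => ?_⟩
  obtain ⟨a, ha, d, h1, h2, h3⟩ := h C
  refine ⟨a, ha, d, h1, h2, fun p hp => ?_⟩
  by_cases h0 : p = 0
  · simp [h0]
  · exact h3 p (Finset.mem_erase.2 ⟨h0, hp⟩)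

open Polynomial in
noncomputable def gpPoly {I : Type} [DecidableEq I] (g : I → ℕ) (S : Finset I) : (I → ℤ)[X] :=
  ∑ i ∈ S, C (Pi.single i (1:ℤ)) * X ^ (g i)

open Polynomial in
lemma gpPoly_eval {I : Type} [DecidableEq I] (g : I → ℕ) (S : Finset I) (d : ℕ) (j : I) :
    ((gpPoly g S).eval (d : I → ℤ)) j = if j ∈ S then (d:ℤ) ^ g j else 0 := by
  simp only [gpPoly, eval_finsetSum, eval_mul, eval_C, eval_pow, eval_X, Finset.sum_apply,
    Pi.mul_apply, Pi.pow_apply, Pi.natCast_apply, Pi.single_apply, ite_mul, one_mul, zero_mul]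
  rw [Finset.sum_ite_eq]

open Polynomial in
lemma gpPoly_eval_zero {I : Type} [DecidableEq I] (g : I → ℕ) (hg : ∀ i, 1 ≤ g i) (S : Finset I) :
    (gpPoly g S).eval 0 = 0 := by
  simp only [gpPoly, eval_finsetSum, eval_mul, eval_C, eval_pow, eval_X]
  refine Finset.sum_eq_zero fun i _ => ?_
  rw [zero_pow (by have := hg i; omega), mul_zero]

lemma gp_pvw {I : Type} [Finite I] [DecidableEq I] (g : I → ℕ) (hg : ∀ i, 1 ≤ g i)
    (α : Type) [Finite α] : ∃ F : Finset (I → ℤ), ∃ M : ℕ, ∀ C : (I → ℤ) → α,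
      ∃ a ∈ F, ∃ d : ℕ, 1 ≤ d ∧ d ≤ M ∧ ∀ S : Finset I,
        C (fun j => a j + if j ∈ S then (d:ℤ) ^ g j else 0) = C a := by
  classical
  have := Fintype.ofFinite I
  have h := pvw (R := (I → ℤ)) ((Finset.univ : Finset (Finset I)).image (gpPoly g))
      (by
        intro p hp
        obtain ⟨S, _, rfl⟩ := Finset.mem_image.1 hp
        exact gpPoly_eval_zero _ hg S)
  obtain ⟨F, M, h⟩ := h α
  refine ⟨F, M, fun C => ?_⟩
  obtain ⟨a, ha, d, h1, h2, h3⟩ := h C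
  refine ⟨a, ha, d, h1, h2, fun S => ?_⟩
  rw [← h3 _ (Finset.mem_image_of_mem _ (Finset.mem_univ S))]
  congr 1
  funext j
  rw [Pi.add_apply, gpPoly_eval]

lemma gp_lemma (α : Type) [Finite α] : ∀ (N : ℕ) (P T : Type) [Finite P] [Finite T] (g : T → ℕ),
    (∀ t, 1 ≤ g t) → ∃ B : ℕ, ∀ C : ℚ → α, ∀ φ : P → ℚ, (∀ p, 0 < φ p) →
      ∀ l : T → ℚ, (∀ t, 0 ≤ l t) → ∃ δ : ℕ, 1 ≤ δ ∧ δ ≤ B ∧ ∃ X : ℚ, 0 < X ∧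
        ∀ e < N, ∀ p, ∀ S : Finset T,
          C (φ p * (δ:ℚ) ^ e * X + ∑ t ∈ S, l t * (δ:ℚ) ^ g t) = C (φ p * (δ:ℚ) ^ e * X) := by
  intro N
  induction N with
  | zero =>
    intro P T _ _ g hg
    exact ⟨1, fun C φ hφ l hl => ⟨1, le_rfl, le_rfl, 1, one_pos, fun e he => absurd he (by omega)⟩⟩
  | succ N ih =>
    intro P T _ _ g hg
    classical
    have := Fintype.ofFinite P
    have := Fintype.ofFinite T
    obtain ⟨F, M, hF⟩ := gp_pvw (fun i : T × P => g i.1) (fun i => hg i.1) (P → α)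
    obtain ⟨K, hK⟩ : ∃ K : ℕ, ∀ a ∈ F, ∀ i, |a i| ≤ (K:ℤ) := by
      refine ⟨∑ a ∈ F, ∑ i, (a i).natAbs, fun a ha i => ?_⟩
      rw [Int.abs_eq_natAbs]
      have h1 := Finset.single_le_sum (f := fun i => (a i).natAbs) (fun i _ => Nat.zero_le _)
        (Finset.mem_univ i)
      have h2 := Finset.single_le_sum (f := fun a : T × P → ℤ => ∑ i, (a i).natAbs)
        (fun i _ => Nat.zero_le _) ha
      exact_mod_cast h1.trans h2
    let T1 := Fin N × Fin M × P × (T × P) × Fin (2*K+1)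
    let T2 := Fin M × T
    obtain ⟨B, hB⟩ := ih (Fin M × Fin N × P) (T1 ⊕ T2)
      (Sum.elim (fun t => g t.2.2.2.1.1 + t.1.1 + 1) (fun t => g t.2))
      (by rintro (t | t) <;> simp [hg])
    refine ⟨B * M, fun C φ hφ l hl => ?_⟩
    obtain ⟨δ₀, hδ1, hδB, X₁, hX₁, h0⟩ := hB C
      (fun t => φ t.2.2 * ((t.1.1 + 1 : ℕ) : ℚ) ^ (t.2.1.1 + 1))
      (fun t => mul_pos (hφ _) (by positivity))
      (Sum.elim (fun t : T1 => φ t.2.2.1 * ((t.2.1.1 + 1 : ℕ) : ℚ) ^ (t.1.1 + 1) *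
          (t.2.2.2.2.1 : ℚ) * l t.2.2.2.1.1 / φ t.2.2.2.1.2)
        (fun t : T2 => l t.2 * ((t.1.1 + 1 : ℕ) : ℚ) ^ g t.2))
      (by
        rintro (t | t)
        · simp only [Sum.elim_inl]
          have h1 := hφ t.2.2.1
          have h2 := hφ t.2.2.2.1.2
          have h3 := hl t.2.2.2.1.1
          positivity
        · simp only [Sum.elim_inr]
          have h3 := hl t.2
          positivity)
    have hδ0 : (0:ℚ) < δ₀ := by exact_mod_cast hδ1
    let θ : T × P → ℚ := fun i => l i.1 / φ i.2 * (δ₀:ℚ) ^ g i.1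
    have hθ : ∀ i, 0 ≤ θ i := fun i => by
      have h2 := hφ i.2
      have h3 := hl i.1
      positivity
    obtain ⟨a, haF, κ, hκ1, hκM, ha⟩ := hF
      (fun v p => C (φ p * (X₁ / δ₀ + ∑ i, ((v i : ℚ) + K) * θ i)))
    obtain ⟨m, rfl⟩ : ∃ m, κ = m + 1 := ⟨κ - 1, by omega⟩
    have hab : ∀ i, ∃ b : Fin (2*K+1), (b.1 : ℚ) = (a i : ℚ) + K := by
      intro i
      have h1 := abs_le.1 (hK a haF i)
      refine ⟨⟨(a i + K).toNat, by omega⟩, ?_⟩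
      have : (((a i + K).toNat : ℤ) : ℚ) = ((a i + K : ℤ) : ℚ) := by
        rw [Int.toNat_of_nonneg (by omega)]
      push_cast at this
      exact_mod_cast this
    choose b hb using hab
    simp only [← hb] at ha
    let X : ℚ := X₁ / δ₀ + ∑ i, (b i : ℚ) * θ i
    have hXpos : 0 < X := by
      refine add_pos_of_pos_of_nonneg (by positivity) (Finset.sum_nonneg fun i _ => ?_)
      exact mul_nonneg (by positivity) (hθ i)
    refine ⟨δ₀ * (m+1), Nat.mul_pos hδ1 hκ1, Nat.mul_le_mul hδB hκM, X, hXpos, ?_⟩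
    intro e he p S
    rcases e with _ | e
    · have h1 := congrFun (ha (S ×ˢ {p})) p
      have h2 : φ p * ((δ₀ * (m+1) : ℕ) : ℚ) ^ 0 * X = φ p * (X₁ / δ₀ + ∑ i, (b i : ℚ) * θ i) := by
        simp [X]
      rw [h2, ← h1]
      congr 1
      have h3 : ∀ i : T × P, (((a i + if i ∈ S ×ˢ {p} then ((m+1:ℕ):ℤ) ^ g i.1 else 0 : ℤ) : ℚ) + K) * θ i
          = b i * θ i + if i ∈ S ×ˢ {p} then ((m+1:ℕ):ℚ) ^ g i.1 * θ i else 0 := by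
        intro i
        rw [hb]
        split_ifs <;> push_cast <;> ring
      simp only [h3]
      rw [Finset.sum_add_distrib, Finset.sum_ite_mem, Finset.univ_inter, Finset.sum_product,
        ← add_assoc, mul_add (φ p) (_ + _)]
      congr 1
      rw [Finset.mul_sum]
      refine Finset.sum_congr rfl fun t _ => ?_
      have := (hφ p).ne'
      simp only [Finset.sum_singleton, θ]
      push_cast
      rw [mul_pow]
      field_simp
    · have heN : e < N := by omega
      have hmM : m < M := by omega
      let S1 : Finset T1 := Finset.univ.image
        (fun i : T × P => ((⟨e, heN⟩, ⟨m, hmM⟩, p, i, b i) : T1))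
      let S2 : Finset T2 := S.image (fun t => ((⟨m, hmM⟩, t) : T2))
      have key1 := h0 e heN (⟨m, hmM⟩, ⟨e, heN⟩, p) (S1.disjSum S2)
      have key2 := h0 e heN (⟨m, hmM⟩, ⟨e, heN⟩, p) (S1.disjSum ∅)
      rw [← key2] at key1
      simp only [Finset.sum_disjSum, Sum.elim_inl, Sum.elim_inr, Finset.sum_empty, add_zero] at key1
      rw [Finset.sum_image (by intro i _ j _ h; exact congrArg (fun t : T1 => t.2.2.2.1) h),
        Finset.sum_image (by intro i _ j _ h; exact congrArg (fun t : T2 => t.2) h)] at key1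
      simp only at key1
      have e1 : φ p * ((δ₀ * (m+1) : ℕ) : ℚ) ^ (e+1) * X =
          φ p * ((m + 1 : ℕ) : ℚ) ^ (e + 1) * (δ₀:ℚ) ^ e * X₁ +
            ∑ i : T × P, φ p * ((m + 1 : ℕ) : ℚ) ^ (e + 1) * (b i : ℚ) * l i.1 / φ i.2 *
              (δ₀ : ℚ) ^ (g i.1 + e + 1) := by
        simp only [X]
        rw [mul_add, Finset.mul_sum]
        congr 1
        · push_cast
          rw [mul_pow]
          field_simp
          try ring
        · refine Finset.sum_congr rfl fun i _ => ?_
          simp only [θ]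
          push_cast
          rw [mul_pow]
          have := (hφ i.2).ne'
          field_simp
          try ring
      have e2 : ∑ t ∈ S, l t * ((δ₀ * (m+1) : ℕ) : ℚ) ^ g t =
          ∑ t ∈ S, l t * ((m + 1 : ℕ) : ℚ) ^ g t * (δ₀ : ℚ) ^ g t := by
        refine Finset.sum_congr rfl fun t _ => ?_
        push_cast
        rw [mul_pow]
        ring
      rw [e1, e2, add_assoc, key1]

lemma claim_lemma (α : Type) [Finite α] (C : ℚ → α) : ∀ (n K : ℕ), ∃ z : ℕ → ℚ, (∀ i, 0 < z i) ∧
    ∀ κ : ℕ, 1 ≤ κ → κ ≤ K → ∀ j < n, ∀ P ⊆ Finset.range j, ∀ Q : Finset (Finset ℕ),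
      (∀ I ∈ Q, I.Nonempty ∧ I ⊆ Finset.range j) →
        C ((κ:ℚ) * z j * ∏ i ∈ P, ((κ:ℚ) * z i) + ∑ I ∈ Q, ∏ i ∈ I, ((κ:ℚ) * z i)) =
          C ((κ:ℚ) * z j * ∏ i ∈ P, ((κ:ℚ) * z i)) := by
  intro n
  induction n with
  | zero =>
    intro K
    exact ⟨fun _ => 1, fun _ => one_pos, fun κ _ _ j hj => absurd hj (by omega)⟩
  | succ n ih =>
    intro K
    classical
    let P' := Fin K × {P : Finset ℕ // P ∈ (Finset.range n).powerset}
    let T' := Fin K × {I : Finset ℕ // I ∈ (Finset.range n).powerset.filter (fun I => I.Nonempty)}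
    obtain ⟨B, hB⟩ := gp_lemma α (n+1) P' T' (fun t => t.2.1.card) (by
      rintro ⟨t, I, hI⟩
      exact (Finset.mem_filter.1 hI).2.card_pos)
    obtain ⟨a, ha0, ha⟩ := ih (K * B)
    obtain ⟨δ, hδ1, hδB, X, hX, h⟩ := hB C
      (fun p => ((p.1.1 + 1 : ℕ) : ℚ) ^ (p.2.1.card + 1) * ∏ i ∈ p.2.1, a i)
      (fun p => mul_pos (by positivity) (Finset.prod_pos fun i _ => ha0 i))
      (fun t => ((t.1.1 + 1 : ℕ) : ℚ) ^ (t.2.1.card) * ∏ i ∈ t.2.1, a i)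
      (fun p => mul_nonneg (by positivity) (Finset.prod_nonneg fun i _ => (ha0 i).le))
    have hδ0 : (0:ℚ) < δ := by exact_mod_cast hδ1
    refine ⟨fun i => if i < n then δ * a i else X, fun i => ?_, ?_⟩
    · dsimp only
      split_ifs
      · exact mul_pos hδ0 (ha0 i)
      · exact hX
    intro κ hκ1 hκK j hj P hP Q hQ
    have hprod : ∀ I : Finset ℕ, I ⊆ Finset.range j → ∏ i ∈ I, ((κ:ℚ) * if i < n then δ * a i else X)
        = ∏ i ∈ I, (((κ * δ : ℕ) : ℚ) * a i) := by
      intro I hI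
      refine Finset.prod_congr rfl fun i hi => ?_
      have := Finset.mem_range.1 (hI hi)
      rw [if_pos (by omega)]
      push_cast
      ring
    rw [hprod P hP, Finset.sum_congr rfl fun I hI => hprod I (hQ I hI).2]
    dsimp only
    rcases Nat.lt_or_ge j n with hjn | hjn
    · have := ha (κ * δ) (Nat.mul_pos hκ1 hδ1) (Nat.mul_le_mul hκK hδB) j hjn P hP Q hQ
      rw [if_pos hjn]
      have e : (κ:ℚ) * (δ * a j) = ((κ * δ : ℕ) : ℚ) * a j := by push_cast; ring
      rw [e, this]
    · have hjn' : j = n := by omega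
      subst hjn'
      rw [if_neg (lt_irrefl _)]
      obtain ⟨m, rfl⟩ : ∃ m, κ = m + 1 := ⟨κ - 1, by omega⟩
      have hPm : P ∈ (Finset.range j).powerset := Finset.mem_powerset.2 hP
      have hPc : P.card < j + 1 := by
        have := Finset.card_le_card hP
        rw [Finset.card_range] at this
        omega
      have hQm : ∀ I ∈ Q, I ∈ (Finset.range j).powerset.filter (fun I => I.Nonempty) := fun I hI =>
        Finset.mem_filter.2 ⟨Finset.mem_powerset.2 (hQ I hI).2, (hQ I hI).1⟩
      let S : Finset T' := Q.attach.image (fun I => ((⟨m, hκK⟩, ⟨I.1, hQm I.1 I.2⟩) : T'))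
      have key := h P.card hPc (⟨m, hκK⟩, ⟨P, hPm⟩) S
      rw [Finset.sum_image (by
        intro I _ J _ hIJ
        exact Subtype.ext (congrArg (fun t : T' => t.2.1) hIJ))] at key
      simp only at key
      rw [Finset.sum_attach Q (fun I => ((m + 1 : ℕ) : ℚ) ^ I.card * (∏ i ∈ I, a i) * (δ:ℚ) ^ I.card)] at key
      have e1 : ((m+1:ℕ):ℚ) * X * ∏ i ∈ P, ((((m+1) * δ : ℕ) : ℚ) * a i) =
          ((m+1:ℕ):ℚ) ^ (P.card + 1) * (∏ i ∈ P, a i) * (δ:ℚ) ^ P.card * X := by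
        rw [Finset.prod_mul_distrib, Finset.prod_const, Nat.cast_mul, mul_pow]
        ring
      have e2 : ∑ I ∈ Q, ∏ i ∈ I, ((((m+1) * δ : ℕ) : ℚ) * a i) =
          ∑ I ∈ Q, ((m + 1 : ℕ) : ℚ) ^ I.card * (∏ i ∈ I, a i) * (δ:ℚ) ^ I.card := by
        refine Finset.sum_congr rfl fun I _ => ?_
        rw [Finset.prod_mul_distrib, Finset.prod_const, Nat.cast_mul, mul_pow]
        ring
      rw [e1, e2, key]

lemma folkman_lemma (α : Type) [Finite α] : ∀ m : ℕ, ∃ N : ℕ, ∀ χ : Finset ℕ → α,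
    ∃ J : ℕ → Finset ℕ, (∀ i < m, (J i).Nonempty ∧ J i ⊆ Finset.range N) ∧
      (∀ i < m, ∀ j < m, i ≠ j → Disjoint (J i) (J j)) ∧
      ∃ col : ℕ → α, ∀ i < m, ∀ S ⊆ Finset.range i, χ (J i ∪ S.biUnion J) = col i := by
  intro m
  induction m with
  | zero =>
    exact ⟨0, fun χ => ⟨fun _ => ∅, fun i hi => absurd hi (by omega),
      fun i hi => absurd hi (by omega), fun _ => χ ∅, fun i hi => absurd hi (by omega)⟩⟩
  | succ m ih =>
    classical
    obtain ⟨N', hN'⟩ := ih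
    obtain ⟨n, hn⟩ := Combinatorics.Subspace.exists_mono_in_high_dimension_fin Bool α (Fin N')
    refine ⟨n + 1, fun χ => ?_⟩
    let V : (Fin n → Prop) → Finset ℕ := fun w =>
      (Finset.univ.filter w).image (fun i : Fin n => i.1 + 1)
    have hV : ∀ w x, x ∈ V w ↔ ∃ i : Fin n, w i ∧ i.1 + 1 = x := by
      intro w x
      simp [V]
    obtain ⟨l, c, hl⟩ := hn (fun w => χ (insert 0 (V (fun i => w i = true))))
    let A : Finset ℕ := insert 0 (V (fun i => l.idxFun i = Sum.inl true))
    let W : ℕ → Finset ℕ := fun e => V (fun i => ∃ h : e < N', l.idxFun i = Sum.inr ⟨e, h⟩)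
    have hWne : ∀ e < N', (W e).Nonempty := by
      intro e he
      obtain ⟨i, hi⟩ := l.proper ⟨e, he⟩
      exact ⟨i.1 + 1, (hV _ _).2 ⟨i, ⟨he, hi⟩, rfl⟩⟩
    have hVN : ∀ w, V w ⊆ Finset.range (n+1) := by
      intro w x hx
      obtain ⟨i, _, rfl⟩ := (hV _ _).1 hx
      simp
    have hWdis : ∀ e e', e ≠ e' → Disjoint (W e) (W e') := by
      intro e e' hne
      rw [Finset.disjoint_left]
      intro x h1 h2
      obtain ⟨i, ⟨he, hi⟩, rfl⟩ := (hV _ _).1 h1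
      obtain ⟨j, ⟨he', hj⟩, hij⟩ := (hV _ _).1 h2
      have : j = i := Fin.ext (by omega)
      subst this
      rw [hi] at hj
      simp at hj
      exact hne hj
    have hWA : ∀ e, Disjoint (W e) A := by
      intro e
      rw [Finset.disjoint_left]
      intro x h1 h2
      obtain ⟨i, ⟨he, hi⟩, rfl⟩ := (hV _ _).1 h1
      rcases Finset.mem_insert.1 h2 with h2 | h2
      · omega
      · obtain ⟨j, hj, hij⟩ := (hV _ _).1 h2
        have : j = i := Fin.ext (by omega)
        subst this
        rw [hi] at hj
        simp at hj
    have hAW : ∀ S : Finset ℕ, χ (A ∪ S.biUnion W) = c := by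
      intro S
      rw [← hl (fun e => decide (e.1 ∈ S))]
      dsimp only
      congr 1
      ext x
      simp only [A, Finset.mem_union, Finset.mem_insert, Finset.mem_biUnion, W, hV, or_assoc]
      refine or_congr Iff.rfl ⟨?_, ?_⟩
      · rintro (⟨i, hi, rfl⟩ | ⟨e, heS, i, ⟨he, hi⟩, rfl⟩)
        · exact ⟨i, by rw [Combinatorics.Subspace.apply_inl hi], rfl⟩
        · exact ⟨i, by rw [Combinatorics.Subspace.apply_inr hi]; simpa using heS, rfl⟩
      · rintro ⟨i, hi, rfl⟩
        rcases hidx : l.idxFun i with b | e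
        · rw [Combinatorics.Subspace.apply_inl hidx] at hi
          exact Or.inl ⟨i, by rw [hidx, hi], rfl⟩
        · rw [Combinatorics.Subspace.apply_inr hidx] at hi
          exact Or.inr ⟨e.1, by simpa using hi, i, ⟨e.2, hidx⟩, rfl⟩
    obtain ⟨J, hJ1, hJ2, col, hcol⟩ := hN' (fun S => χ (S.biUnion W))
    have hJA : ∀ i, Disjoint ((J i).biUnion W) A := by
      intro i
      rw [Finset.disjoint_biUnion_left]
      exact fun e _ => hWA e
    have hbi : ∀ S : Finset ℕ, S ⊆ Finset.range m →
        S.biUnion (fun i => if i < m then (J i).biUnion W else A) = (S.biUnion J).biUnion W := by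
      intro S hS
      rw [Finset.biUnion_biUnion]
      refine Finset.biUnion_congr rfl fun i hi => ?_
      rw [if_pos (Finset.mem_range.1 (hS hi))]
    refine ⟨fun i => if i < m then (J i).biUnion W else A, ?_, ?_,
      fun i => if i < m then col i else c, ?_⟩
    · intro i _
      dsimp only
      split_ifs with hi
      · obtain ⟨⟨e, he⟩, hsub⟩ := hJ1 i hi
        refine ⟨?_, ?_⟩
        · obtain ⟨x, hx⟩ := hWne e (Finset.mem_range.1 (hsub he))
          exact ⟨x, Finset.mem_biUnion.2 ⟨e, he, hx⟩⟩
        · rw [Finset.biUnion_subset]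
          exact fun e _ => hVN _
      · refine ⟨⟨0, Finset.mem_insert_self _ _⟩, ?_⟩
        rw [Finset.insert_subset_iff]
        exact ⟨by simp, hVN _⟩
    · intro i hi j hj hij
      dsimp only
      split_ifs with h1 h2 h2
      · rw [Finset.disjoint_biUnion_left]
        intro e he
        rw [Finset.disjoint_biUnion_right]
        intro e' he'
        apply hWdis
        rintro rfl
        exact Finset.disjoint_left.1 (hJ2 i h1 j h2 hij) he he'
      · exact hJA i
      · exact (hJA j).symm
      · omega
    · intro i hi S hS
      dsimp only
      rw [hbi S (hS.trans (Finset.range_mono (by omega)))]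
      split_ifs with h1
      · rw [← hcol i h1 S hS]
        rw [Finset.union_biUnion]
      · exact hAW _

lemma folkman_mono (r k : ℕ) : ∃ N : ℕ, ∀ χ : Finset ℕ → Fin r,
    ∃ J : Fin k → Finset ℕ, (∀ i, (J i).Nonempty ∧ J i ⊆ Finset.range N) ∧
      (∀ i j, i ≠ j → Disjoint (J i) (J j)) ∧
      ∃ c : Fin r, ∀ S : Finset (Fin k), S.Nonempty → χ (S.biUnion J) = c := by
  classical
  obtain ⟨N, hN⟩ := folkman_lemma (Fin r) (r * k)
  refine ⟨N, fun χ => ?_⟩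
  obtain ⟨J, hJ1, hJ2, col, hcol⟩ := hN χ
  have : Nonempty (Fin r) := ⟨χ ∅⟩
  obtain ⟨c, -, hc⟩ := Finset.exists_le_card_fiber_of_mul_le_card_of_maps_to
    (s := Finset.range (r*k)) (t := (Finset.univ : Finset (Fin r))) (f := col) (n := k)
    (fun _ _ => Finset.mem_univ _) Finset.univ_nonempty (by simp)
  obtain ⟨T, hTsub, hTcard⟩ := Finset.exists_subset_card_eq hc
  let f := T.orderEmbOfFin hTcard
  have hf : ∀ i, f i < r * k ∧ col (f i) = c := by
    intro i
    have := hTsub (T.orderEmbOfFin_mem hTcard i)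
    simpa using this
  refine ⟨fun i => J (f i), fun i => hJ1 _ (hf i).1, fun i j hij =>
    hJ2 _ (hf i).1 _ (hf j).1 (fun h => hij (f.injective h)), c, fun S hS => ?_⟩
  have h1 := hcol (f (S.max' hS)) (hf _).1 ((S.erase (S.max' hS)).image f) (by
    intro x hx
    obtain ⟨i, hi, rfl⟩ := Finset.mem_image.1 hx
    rw [Finset.mem_range]
    exact f.strictMono (Finset.lt_max'_of_mem_erase_max' S hS hi))
  rw [(hf _).2] at h1
  rw [← h1, Finset.image_biUnion]
  congr 1
  conv_lhs => rw [← Finset.insert_erase (S.max'_mem hS)]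
  rw [Finset.biUnion_insert]

lemma top_term {α : Type} (C : ℚ → α) (z : ℕ → ℚ) (N : ℕ)
    (hz : ∀ j < N, ∀ P ⊆ Finset.range j, ∀ Q : Finset (Finset ℕ),
      (∀ I ∈ Q, I.Nonempty ∧ I ⊆ Finset.range j) →
        C (z j * ∏ i ∈ P, z i + ∑ I ∈ Q, ∏ i ∈ I, z i) = C (z j * ∏ i ∈ P, z i))
    (F : Finset (Finset ℕ)) (hF : F.Nonempty) (hF1 : ∀ I ∈ F, I.Nonempty ∧ I ⊆ Finset.range N)
    (hF2 : ∀ I ∈ F, ∀ J ∈ F, I ≠ J → Disjoint I J) :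
    ∃ I ∈ F, C (∑ I ∈ F, ∏ i ∈ I, z i) = C (∏ i ∈ I, z i) := by
  classical
  have hU : (F.biUnion id).Nonempty := by
    obtain ⟨I, hI⟩ := hF
    obtain ⟨x, hx⟩ := (hF1 I hI).1
    exact ⟨x, Finset.mem_biUnion.2 ⟨I, hI, hx⟩⟩
  obtain ⟨I, hI, hmI⟩ := Finset.mem_biUnion.1 ((F.biUnion id).max'_mem hU)
  have hle : ∀ J ∈ F, ∀ x ∈ J, x ≤ (F.biUnion id).max' hU := fun J hJ x hx =>
    Finset.le_max' _ _ (Finset.mem_biUnion.2 ⟨J, hJ, hx⟩)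
  generalize (F.biUnion id).max' hU = m at hmI hle
  simp only [id] at hmI
  refine ⟨I, hI, ?_⟩
  have := hz m (Finset.mem_range.1 ((hF1 I hI).2 hmI)) (I.erase m) (by
    intro x hx
    have h1 := hle I hI x (Finset.mem_of_mem_erase hx)
    have h2 := Finset.ne_of_mem_erase hx
    rw [Finset.mem_range]
    omega) (F.erase I) (by
    intro J hJ
    have hJF := Finset.mem_of_mem_erase hJ
    refine ⟨(hF1 J hJF).1, fun x hx => ?_⟩
    have h1 := hle J hJF x hx
    have h2 : x ≠ m := by
      rintro rfl
      exact Finset.disjoint_left.1 (hF2 J hJF I hI (Finset.ne_of_mem_erase hJ)) hx hmI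
    rw [Finset.mem_range]
    omega)
  rwa [Finset.mul_prod_erase I z hmI, Finset.add_sum_erase F (fun I => ∏ i ∈ I, z i) hI] at this

/-- **Generalized Hindman's theorem over the rationals** (sums of disjoint products).
For all positive integers `r` and `k`, and every `r`-coloring `C` of the positive
rationals, there exist positive rationals `x 1, …, x k` such that the set of all
sums `Σ_{j=1}^ℓ Π_{i ∈ I_j} x i` over nonempty pairwise disjoint subsets
`I₁, …, I_ℓ` of `[k]` (with `ℓ ≥ 1`) is monochromatic under `C`.  Since nonempty
pairwise disjoint sets are distinct, such a list is encoded as a nonempty finite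
collection of nonempty pairwise disjoint subsets of `Fin k`. -/
theorem generalized_hindman_over_rationals (r k : ℕ) (hr : 0 < r) (hk : 0 < k)
    (C : ℚ → Fin r) :
    ∃ x : Fin k → ℚ, (∀ i, 0 < x i) ∧
      ∃ col : Fin r,
        ∀ 𝓘 : Finset (Finset (Fin k)), 𝓘.Nonempty →
          (∀ I ∈ 𝓘, I.Nonempty) →
          (∀ I ∈ 𝓘, ∀ J ∈ 𝓘, I ≠ J → Disjoint I J) →
          C (∑ I ∈ 𝓘, ∏ i ∈ I, x i) = col := by
  classical
  obtain ⟨N, hN⟩ := folkman_mono r k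
  obtain ⟨z, hz0, hz⟩ := claim_lemma (Fin r) C N 1
  have hz' := hz 1 le_rfl le_rfl
  simp only [Nat.cast_one, one_mul] at hz'
  obtain ⟨J, hJ1, hJ2, c, hc⟩ := hN (fun S => C (∏ i ∈ S, z i))
  refine ⟨fun i => ∏ j ∈ J i, z j, fun i => Finset.prod_pos fun j _ => hz0 j, c, ?_⟩
  intro 𝓘 hne hne1 hdis
  have hprod : ∀ I : Finset (Fin k), ∏ i ∈ I, ∏ j ∈ J i, z j = ∏ j ∈ I.biUnion J, z j := by
    intro I
    rw [Finset.prod_biUnion]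
    intro i _ j _ hij
    exact hJ2 i j hij
  have hU : ∀ I ∈ 𝓘, (I.biUnion J).Nonempty := by
    intro I hI
    obtain ⟨i, hi⟩ := hne1 I hI
    obtain ⟨x, hx⟩ := (hJ1 i).1
    exact ⟨x, Finset.mem_biUnion.2 ⟨i, hi, hx⟩⟩
  have hUdis : ∀ I ∈ 𝓘, ∀ I' ∈ 𝓘, I ≠ I' → Disjoint (I.biUnion J) (I'.biUnion J) := by
    intro I hI I' hI' hII
    rw [Finset.disjoint_biUnion_left]
    intro i hi
    rw [Finset.disjoint_biUnion_right]
    intro j hj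
    apply hJ2
    rintro rfl
    exact Finset.disjoint_left.1 (hdis I hI I' hI' hII) hi hj
  have hinj : Set.InjOn (fun I : Finset (Fin k) => I.biUnion J) (𝓘 : Set (Finset (Fin k))) := by
    intro I hI I' hI' h
    by_contra hne'
    have h1 := hUdis I hI I' hI' hne'
    simp only at h
    rw [← h, Finset.disjoint_self_iff_empty] at h1
    exact (hU I hI).ne_empty h1
  simp only [hprod]
  obtain ⟨K, hK, hKC⟩ := top_term C z N hz' (𝓘.image (fun I => I.biUnion J)) (hne.image _)
    (by
      intro K hK
      obtain ⟨I, hI, rfl⟩ := Finset.mem_image.1 hK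
      refine ⟨hU I hI, ?_⟩
      rw [Finset.biUnion_subset]
      exact fun i _ => (hJ1 i).2)
    (by
      intro K hK K' hK' hne'
      obtain ⟨I, hI, rfl⟩ := Finset.mem_image.1 hK
      obtain ⟨I', hI', rfl⟩ := Finset.mem_image.1 hK'
      exact hUdis I hI I' hI' (fun h => hne' (by rw [h])))
  rw [Finset.sum_image hinj] at hKC
  rw [hKC]
  obtain ⟨I, hI, rfl⟩ := Finset.mem_image.1 hK
  exact hc I (hne1 I hI)
end

section
/- For all positive integers r and n there exists a finite set S ⊆ ℚ₊ such that for every coloring C : S → {1,…,r} there exists a vector v = (v₁,…,v_n) ∈ Sⁿ with the property that for every n-family 𝓘 with |f(𝓘)| ≤ |I'| for all I' ∈ 𝓘, both φ_𝓘(v) and Π_{i∈f(𝓘)} v_i belong to S and C(φ_𝓘(v)) = C(Π_{i∈f(𝓘)} v_i). -/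
/-- An `n`-family: a nonempty finite collection of pairwise disjoint nonempty
subsets of `[n] = {1,…,n}`. -/
def IsNFamily (n : ℕ) (𝓘 : Finset (Finset ℕ)) : Prop :=
  𝓘.Nonempty ∧ (∀ I ∈ 𝓘, I.Nonempty ∧ I ⊆ Finset.Icc 1 n) ∧
    (∀ I ∈ 𝓘, ∀ J ∈ 𝓘, I ≠ J → Disjoint I J)

/-- `L = f(𝓘)`: the member of `𝓘` whose maximum exceeds the maximum of every
other member. -/
def IsLeading (𝓘 : Finset (Finset ℕ)) (L : Finset ℕ) : Prop :=
  L ∈ 𝓘 ∧ ∀ I ∈ 𝓘, I ≠ L → I.max < L.max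

/-- `φ_𝓘(v) = Σ_{I ∈ 𝓘} Π_{i ∈ I} v i`. -/
def phi (𝓘 : Finset (Finset ℕ)) (v : ℕ → ℚ) : ℚ := ∑ I ∈ 𝓘, ∏ i ∈ I, v i

section helpers
open Polynomial

/-- Polynomial van der Waerden property of a finite set of polynomials (uniform version). -/
def PGood {R : Type} [CommRing R] (A : Finset R[X]) : Prop :=
  ∀ (κ : Type) [Finite κ], ∃ (Y : Finset R) (H : ℕ), ∀ c : R → κ,
    ∃ a ∈ Y, ∃ d : ℕ, 1 ≤ d ∧ d ≤ H ∧ ∀ p ∈ A, c (a + p.eval (d : R)) = c a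

/-- difference polynomials -/
noncomputable def gpoly {R : Type} [CommRing R] (p₁ p : R[X]) (u : ℕ) : R[X] :=
  p.comp (X + C (u : R)) - C (p.eval (u : R)) - p₁

lemma gpoly_eval {R : Type} [CommRing R] (p₁ p : R[X]) (u d : ℕ) :
    (gpoly p₁ p u).eval (d : R) =
      p.eval ((d + u : ℕ) : R) - p.eval (u : R) - p₁.eval (d : R) := by
  simp [gpoly]

open Classical in
lemma focus {R : Type} [CommRing R] (A : Finset R[X]) (p₁ : R[X]) (hp₁ : p₁ ∈ A)
    (h0 : ∀ p ∈ A, p.eval 0 = 0)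
    (ih : ∀ H : ℕ, PGood ((A ×ˢ Finset.range (H + 1)).image (fun x => gpoly p₁ x.1 x.2)))
    (κ : Type) [Finite κ] (k : ℕ) :
    ∃ (Y : Finset R) (H : ℕ), ∀ c : R → κ,
      (∃ a ∈ Y, ∃ d : ℕ, 1 ≤ d ∧ d ≤ H ∧ ∀ p ∈ A, c (a + p.eval (d : R)) = c a) ∨
      (∃ a ∈ Y, ∃ T : Finset κ, T.card = k ∧
        ∀ γ ∈ T, ∃ d : ℕ, 1 ≤ d ∧ d ≤ H ∧ ∀ p ∈ A, c (a + p.eval (d : R)) = γ) := by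
  induction k with
  | zero => exact ⟨{0}, 1, fun c => Or.inr ⟨0, by simp, ∅, by simp, by simp⟩⟩
  | succ k ihk =>
    obtain ⟨Y, H, hF⟩ := ihk
    set Y' : Finset R := (Y ×ˢ (A ×ˢ Finset.range (H + 1))).image
      (fun x => x.1 + x.2.1.eval (x.2.2 : R)) with hY'
    have memY' : ∀ a ∈ Y, ∀ p ∈ A, ∀ u ≤ H, a + p.eval (u : R) ∈ Y' := by
      intro a ha p hp u hu
      rw [hY', Finset.mem_image]
      refine ⟨(a, p, u), ?_, rfl⟩
      simp only [Finset.mem_product, Finset.mem_range]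
      exact ⟨ha, hp, by omega⟩
    have memY'0 : ∀ a ∈ Y, a ∈ Y' := by
      intro a ha
      have := memY' a ha p₁ hp₁ 0 (Nat.zero_le _)
      simpa [h0 p₁ hp₁] using this
    obtain ⟨Y1, H1, hI⟩ := ih H (Y' → κ)
    refine ⟨(Y1 ×ˢ Y).image (fun x => x.1 + x.2) ∪
      ((Y1 ×ˢ Y) ×ˢ Finset.range (H1 + 1)).image
        (fun x => x.1.1 + x.1.2 - p₁.eval (x.2 : R)), H + H1, fun c => ?_⟩
    obtain ⟨a', ha', d1, hd1, hd1H, hc'⟩ := hI (fun x y => c (x + y))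
    have hc : ∀ p ∈ A, ∀ u ≤ H, ∀ y ∈ Y',
        c (a' + (gpoly p₁ p u).eval (d1 : R) + y) = c (a' + y) := by
      intro p hp u hu y hy
      have := hc' (gpoly p₁ p u) (Finset.mem_image.2 ⟨(p, u), by
        simp only [Finset.mem_product, Finset.mem_range]; exact ⟨hp, by omega⟩, rfl⟩)
      exact congrFun this ⟨y, hy⟩
    have mem1 : ∀ a ∈ Y, a' + a ∈ (Y1 ×ˢ Y).image (fun x => x.1 + x.2) := by
      intro a ha
      exact Finset.mem_image.2 ⟨(a', a), by simp [ha', ha], rfl⟩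
    rcases hF (fun x => c (a' + x)) with ⟨a, ha, d, hd, hdH, hm⟩ | ⟨a, ha, T, hT, hm⟩
    · left
      refine ⟨a' + a, Finset.mem_union_left _ (mem1 a ha), d, hd, by omega, fun p hp => ?_⟩
      rw [add_assoc]; exact hm p hp
    · by_cases hin : c (a' + a) ∈ T
      · left
        obtain ⟨d, hd, hdH, hmm⟩ := hm _ hin
        refine ⟨a' + a, Finset.mem_union_left _ (mem1 a ha), d, hd, by omega, fun p hp => ?_⟩
        rw [add_assoc]; exact hmm p hp
      · right
        refine ⟨a' + a - p₁.eval (d1 : R), Finset.mem_union_right _ ?_,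
          insert (c (a' + a)) T, by rw [Finset.card_insert_of_notMem hin, hT], ?_⟩
        · exact Finset.mem_image.2 ⟨((a', a), d1), by
            simp only [Finset.mem_product, Finset.mem_range]
            exact ⟨⟨ha', ha⟩, by omega⟩, rfl⟩
        · intro γ hγ
          rcases Finset.mem_insert.1 hγ with rfl | hγ
          · refine ⟨d1, hd1, by omega, fun p hp => ?_⟩
            rw [← hc p hp 0 (Nat.zero_le _) a (memY'0 a ha), gpoly_eval]
            congr 1
            simp [h0 p hp]; ring
          · obtain ⟨d, hd, hdH, hmm⟩ := hm γ hγ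
            refine ⟨d1 + d, by omega, by omega, fun p hp => ?_⟩
            rw [← hmm p hp, ← hc p hp d hdH _ (memY' a ha p hp d hdH), gpoly_eval]
            congr 1
            ring

open Classical in
/-- leading coefficients in degree `i` -/
noncomputable def leads {R : Type} [CommRing R] (A : Finset R[X]) (i : ℕ) : Finset R :=
  (A.filter (fun p => p.natDegree = i)).image (fun p => p.coeff i)

lemma gpoly_coeff {R : Type} [CommRing R] (p₁ p : R[X]) (u i : ℕ) (hi : 0 < i)
    (hp : p.natDegree ≤ i) :
    (gpoly p₁ p u).coeff i = p.coeff i - p₁.coeff i := by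
  have h1 : (p.comp (X + C (u : R))).coeff i = p.coeff i := by
    rw [← taylor_apply]
    rcases hp.lt_or_eq with h | h
    · rw [coeff_eq_zero_of_natDegree_lt h, coeff_eq_zero_of_natDegree_lt]
      rwa [natDegree_taylor]
    · subst h
      rw [coeff_taylor_natDegree]; rfl
  rw [gpoly, coeff_sub, coeff_sub, h1, coeff_C, if_neg hi.ne', sub_zero]

lemma gpoly_natDegree_le {R : Type} [CommRing R] (p₁ p : R[X]) (u i : ℕ)
    (hp : p.natDegree ≤ i) (hp₁ : p₁.natDegree ≤ i) : (gpoly p₁ p u).natDegree ≤ i := by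
  unfold gpoly
  refine (natDegree_sub_le _ _).trans (max_le ((natDegree_sub_le _ _).trans (max_le ?_ ?_)) hp₁)
  · rw [← taylor_apply, natDegree_taylor]; exact hp
  · simp

open Classical in
theorem pvdw {R : Type} [CommRing R] (D : ℕ) (A : Finset R[X])
    (h0 : ∀ p ∈ A, p.eval 0 = 0) (hD : ∀ p ∈ A, p.natDegree ≤ D) : PGood A := by
  have wf : WellFounded (InvImage
      (Pi.Lex (fun a b : Fin (D + 1) => b < a) (fun {_} (a b : ℕ) => a < b))
      (fun (A : Finset R[X]) (i : Fin (D + 1)) => (leads (A.filter (fun p => p ≠ 0)) i).card)) := by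
    apply InvImage.wf
    apply Pi.Lex.wellFounded
    intro i
    exact wellFounded_lt
  induction A using wf.induction with
  | _ A IH =>
  intro κ _
  haveI := Fintype.ofFinite κ
  set A0 := A.filter (fun p => p ≠ 0) with hA0
  rcases A0.eq_empty_or_nonempty with he | hne
  · refine ⟨{0}, 1, fun c => ⟨0, by simp, 1, le_rfl, le_rfl, fun p hp => ?_⟩⟩
    have : p = 0 := by
      by_contra hp0
      have : p ∈ A0 := by simp [hA0, hp, hp0]
      rw [he] at this; simp at this
    simp [this]
  · obtain ⟨p₁, hp₁, hmin⟩ := Finset.exists_min_image A0 natDegree hne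
    have h0' : ∀ p ∈ A0, p.eval 0 = 0 := fun p hp => h0 p (Finset.mem_filter.1 hp).1
    have hD' : ∀ p ∈ A0, p.natDegree ≤ D := fun p hp => hD p (Finset.mem_filter.1 hp).1
    have hpos : ∀ p ∈ A0, 0 < p.natDegree := by
      intro p hp
      rcases Nat.eq_zero_or_pos p.natDegree with h | h
      · exfalso
        apply (Finset.mem_filter.1 hp).2
        rw [eq_C_of_natDegree_eq_zero h, coeff_zero_eq_eval_zero, h0' p hp, C_0]
      · exact h
    have ih : ∀ H : ℕ, PGood ((A0 ×ˢ Finset.range (H + 1)).image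
        (fun x => gpoly p₁ x.1 x.2)) := by
      intro H
      set B := (A0 ×ˢ Finset.range (H + 1)).image (fun x => gpoly p₁ x.1 x.2) with hB
      have memB : ∀ g ∈ B, ∃ p ∈ A0, ∃ u : ℕ, u ≤ H ∧ g = gpoly p₁ p u := by
        intro g hg
        obtain ⟨⟨p, u⟩, hx, rfl⟩ := Finset.mem_image.1 hg
        simp only [Finset.mem_product, Finset.mem_range] at hx
        exact ⟨p, hx.1, u, by omega, rfl⟩
      have hj := hpos p₁ hp₁
      -- degree of an element
      have hbig : ∀ p ∈ A0, ∀ u, p₁.natDegree < p.natDegree →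
          (gpoly p₁ p u).natDegree = p.natDegree := by
        intro p hp u hlt
        refine le_antisymm (gpoly_natDegree_le _ _ _ _ le_rfl hlt.le) ?_
        apply le_natDegree_of_ne_zero
        rw [gpoly_coeff _ _ _ _ (hpos p hp) le_rfl, coeff_eq_zero_of_natDegree_lt hlt, sub_zero]
        exact leadingCoeff_ne_zero.2 (Finset.mem_filter.1 hp).2
      apply IH
      · refine ⟨⟨p₁.natDegree, Nat.lt_succ_of_le (hD' p₁ hp₁)⟩, ?_, ?_⟩
        · intro i hi
          have hi : p₁.natDegree < (i : ℕ) := hi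
          show (leads (B.filter (fun p => p ≠ 0)) i).card = (leads A0 i).card
          congr 1
          ext x
          simp only [leads, Finset.mem_image, Finset.mem_filter]
          constructor
          · rintro ⟨g, ⟨⟨hg, hg0⟩, hgi⟩, rfl⟩
            obtain ⟨p, hp, u, hu, rfl⟩ := memB g hg
            have hlt : p₁.natDegree < p.natDegree := by
              by_contra hcon
              have := gpoly_natDegree_le p₁ p u _ (not_lt.1 hcon) le_rfl
              omega
            rw [hbig p hp u hlt] at hgi
            refine ⟨p, ⟨hp, hgi⟩, ?_⟩
            rw [gpoly_coeff _ _ _ _ (by omega) hgi.le, coeff_eq_zero_of_natDegree_lt hi, sub_zero]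
          · rintro ⟨p, ⟨hp, hpi⟩, rfl⟩
            have hlt : p₁.natDegree < p.natDegree := by omega
            have hdeg := hbig p hp 0 hlt
            refine ⟨gpoly p₁ p 0, ⟨⟨?_, ?_⟩, hdeg.trans hpi⟩, ?_⟩
            · exact Finset.mem_image.2 ⟨(p, 0), by simp [hp], rfl⟩
            · intro h
              rw [h, natDegree_zero] at hdeg
              omega
            · rw [gpoly_coeff _ _ _ _ (by omega) hpi.le, coeff_eq_zero_of_natDegree_lt hi,
                sub_zero]
        · show (leads (B.filter (fun p => p ≠ 0)) p₁.natDegree).card <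
            (leads A0 p₁.natDegree).card
          have hmem : p₁.coeff p₁.natDegree ∈ leads A0 p₁.natDegree := by
            simp only [leads, Finset.mem_image, Finset.mem_filter]
            exact ⟨p₁, ⟨hp₁, rfl⟩, rfl⟩
          have hsub : leads (B.filter (fun p => p ≠ 0)) p₁.natDegree ⊆
              ((leads A0 p₁.natDegree).erase (p₁.coeff p₁.natDegree)).image
                (fun x => x - p₁.coeff p₁.natDegree) := by
            intro x hx
            simp only [leads, Finset.mem_image, Finset.mem_filter] at hx
            obtain ⟨g, ⟨⟨hg, hg0⟩, hgi⟩, rfl⟩ := hx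
            obtain ⟨p, hp, u, hu, rfl⟩ := memB g hg
            have hple : p.natDegree = p₁.natDegree := by
              refine le_antisymm ?_ (hmin p hp)
              by_contra hcon
              have := hbig p hp u (not_le.1 hcon)
              omega
            have hco := gpoly_coeff p₁ p u _ hj hple.le
            refine Finset.mem_image.2 ⟨p.coeff p₁.natDegree, ?_, hco.symm⟩
            refine Finset.mem_erase.2 ⟨?_, ?_⟩
            · intro heq
              rw [heq, sub_self, ← hgi] at hco
              exact hg0 (leadingCoeff_eq_zero.1 hco)
            · simp only [leads, Finset.mem_image, Finset.mem_filter]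
              exact ⟨p, ⟨hp, hple⟩, rfl⟩
          calc _ ≤ _ := Finset.card_le_card hsub
            _ ≤ _ := Finset.card_image_le
            _ < _ := Finset.card_erase_lt_of_mem hmem
      · intro g hg
        obtain ⟨p, hp, u, hu, rfl⟩ := memB g hg
        have := gpoly_eval p₁ p u 0
        simpa [h0' p₁ hp₁] using this
      · intro g hg
        obtain ⟨p, hp, u, hu, rfl⟩ := memB g hg
        exact gpoly_natDegree_le _ _ _ _ (hD' p hp) (hD' p₁ hp₁)
    obtain ⟨Y, H, hF⟩ := focus A0 p₁ hp₁ h0' ih κ (Fintype.card κ)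
    refine ⟨Y, H, fun c => ?_⟩
    have key : ∃ a ∈ Y, ∃ d : ℕ, 1 ≤ d ∧ d ≤ H ∧ ∀ p ∈ A0, c (a + p.eval (d : R)) = c a := by
      rcases hF c with h | ⟨a, ha, T, hT, hm⟩
      · exact h
      · have hT' : T = Finset.univ := Finset.card_eq_iff_eq_univ T |>.1 hT
        obtain ⟨d, hd⟩ := hm (c a) (by simp [hT'])
        exact ⟨a, ha, d, hd⟩
    obtain ⟨a, ha, d, hd, hdH, hm⟩ := key
    refine ⟨a, ha, d, hd, hdH, fun p hp => ?_⟩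
    by_cases hp0 : p = 0
    · simp [hp0]
    · exact hm p (by simp [hA0, hp, hp0])

theorem scale (K : ℕ) : ∀ (R : Type) [CommRing R] (Q : Finset R[X]) (κ : Type) [Finite κ],
    ∃ E : Finset ℕ, (∀ e ∈ E, 0 < e) ∧ ∀ (φ : R →+* ℚ) (c : ℕ → ℚ → κ),
      ∃ e ∈ E, ∃ b : ℚ, 0 < b ∧ ∀ q ∈ Q, 0 < b + q.eval₂ φ (e : ℚ) ∧
        ∀ k < K, c k ((e : ℚ) ^ (k + 1) * (b + q.eval₂ φ (e : ℚ))) = c k ((e : ℚ) ^ (k + 1) * b) := by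
  classical
  induction K with
  | zero =>
    intro R _ Q κ _
    refine ⟨{1}, by simp, fun φ c => ⟨1, by simp, 1 + ∑ q ∈ Q, |q.eval₂ φ ((1 : ℕ) : ℚ)|, ?_, ?_⟩⟩
    · have : 0 ≤ ∑ q ∈ Q, |q.eval₂ φ ((1 : ℕ) : ℚ)| := Finset.sum_nonneg (fun _ _ => abs_nonneg _)
      linarith
    · intro q hq
      refine ⟨?_, by simp⟩
      have h1 := Finset.single_le_sum (f := fun q : R[X] => |q.eval₂ φ ((1 : ℕ) : ℚ)|)
        (fun _ _ => abs_nonneg _) hq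
      have h2 := neg_abs_le (q.eval₂ φ ((1 : ℕ) : ℚ))
      linarith
  | succ K ih =>
    intro R _ Q κ _
    -- the polynomials `Y^(K+1) q(XY)` over `R[X]`
    set P : R[X] → R[X][X] := fun q =>
      X ^ (K + 1) * q.eval₂ ((C : R[X] →+* R[X][X]).comp C) (C X * X) with hP
    have hPe : ∀ q (h : ℕ), (P q).eval (h : R[X]) = (h : R[X]) ^ (K + 1) * q.comp ((h : R[X]) * X) := by
      intro q h
      simp only [hP, eval_mul, eval_pow, eval_X]
      congr 1
      have := hom_eval₂ q ((C : R[X] →+* R[X][X]).comp C) (evalRingHom (h : R[X])) (C X * X)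
      rw [coe_evalRingHom] at this
      rw [this, comp]
      congr 1
      · ext x; simp
      · rw [eval_mul, eval_C, eval_X, mul_comm]
    obtain ⟨Y, H, hv⟩ := pvdw ((Q.image P).sup natDegree) (Q.image P) (by
        intro p hp
        obtain ⟨q, hq, rfl⟩ := Finset.mem_image.1 hp
        simp [hP]) (fun p hp => Finset.le_sup (f := natDegree) hp) κ
    set Q' : Finset R[X] := Y ∪ (Y ×ˢ (Finset.range (H + 1) ×ˢ Q)).image
      (fun x => x.1 + (P x.2.2).eval (x.2.1 : R[X])) with hQ'
    obtain ⟨E', hE', hs⟩ := ih R Q' (Fin (H + 1) → κ)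
    refine ⟨(E' ×ˢ Finset.Icc 1 H).image (fun x => x.1 * x.2), ?_, fun φ c => ?_⟩
    · intro e he
      obtain ⟨⟨f, h⟩, hx, rfl⟩ := Finset.mem_image.1 he
      simp only [Finset.mem_product, Finset.mem_Icc] at hx
      exact Nat.mul_pos (hE' _ hx.1) (by omega)
    · obtain ⟨f, hf, b', hb', hq'⟩ := hs φ
        (fun k x h => c k (x * ((h : ℕ) : ℚ) ^ (k + 1) / ((h : ℕ) : ℚ) ^ (K + 1)))
      obtain ⟨y, hy, h, h1, hH, hm⟩ := hv
        (fun x => c K ((f : ℚ) ^ (K + 1) * (b' + x.eval₂ φ (f : ℚ))))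
      have hf0 : (f : ℚ) ≠ 0 := by exact_mod_cast (hE' f hf).ne'
      have hh0 : (h : ℚ) ≠ 0 := by
        have : h ≠ 0 := by omega
        exact_mod_cast this
      have hhp : (0 : ℚ) < (h : ℚ) ^ (K + 1) := by positivity
      have hev : ∀ q : R[X], ((P q).eval (h : R[X])).eval₂ φ (f : ℚ) =
          (h : ℚ) ^ (K + 1) * q.eval₂ φ ((f : ℚ) * h) := by
        intro q
        rw [hPe, eval₂_mul, eval₂_pow, eval₂_comp]
        simp [eval₂_mul, mul_comm]
      have hy' := hq' y (Finset.mem_union_left _ hy)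
      refine ⟨f * h, Finset.mem_image.2 ⟨(f, h), by simp [hf, h1, hH], rfl⟩,
        (b' + y.eval₂ φ (f : ℚ)) / (h : ℚ) ^ (K + 1), div_pos hy'.1 hhp, fun q hq => ?_⟩
      have hyq := hq' (y + (P q).eval (h : R[X])) (Finset.mem_union_right _
        (Finset.mem_image.2 ⟨(y, h, q), by
          simp only [Finset.mem_product, Finset.mem_range]; exact ⟨hy, by omega, hq⟩, rfl⟩))
      rw [eval₂_add, hev] at hyq
      have hrew : (b' + y.eval₂ φ (f : ℚ)) / (h : ℚ) ^ (K + 1) + q.eval₂ φ ((f * h : ℕ) : ℚ) =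
          (b' + (y.eval₂ φ (f : ℚ) + (h : ℚ) ^ (K + 1) * q.eval₂ φ ((f : ℚ) * h))) /
            (h : ℚ) ^ (K + 1) := by
        push_cast
        field_simp
        ring
      rw [hrew]
      refine ⟨div_pos hyq.1 hhp, fun k hk => ?_⟩
      rcases Nat.lt_succ_iff_lt_or_eq.1 hk with hk | rfl
      · have e1 := congrFun (hyq.2 k hk) ⟨h, by omega⟩
        have e2 := congrFun (hy'.2 k hk) ⟨h, by omega⟩
        simp only at e1 e2
        have e3 := e1.trans e2.symm
        convert e3 using 2
        · push_cast; ring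
        · push_cast; ring
      · have e1 := hm (P q) (Finset.mem_image_of_mem _ hq)
        simp only [eval₂_add, hev] at e1
        convert e1 using 2
        · push_cast; field_simp; ring
        · push_cast; field_simp; ring

def LC {r : ℕ} (n : ℕ) (Co : ℚ → Fin r) (v : ℕ → ℚ) : Prop :=
  ∀ 𝓘 : Finset (Finset ℕ), IsNFamily n 𝓘 → ∀ F : Finset ℕ, IsLeading 𝓘 F →
    (∀ I' ∈ 𝓘, F.card ≤ I'.card) → Co (phi 𝓘 v) = Co (∏ i ∈ F, v i)

theorem exists_LC (r n : ℕ) : ∀ T : Finset ℕ, (∀ t ∈ T, 0 < t) → ∀ Co : ℚ → Fin r,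
    ∃ v : ℕ → ℚ, (∀ i, 0 < v i) ∧ ∀ t ∈ T, LC n Co (fun i => (t : ℚ) * v i) := by
  classical
  induction n with
  | zero =>
    intro T hT Co
    refine ⟨fun _ => 1, by simp, fun t ht 𝓘 h𝓘 F hF _ => ?_⟩
    obtain ⟨⟨x, hx⟩, hs⟩ := h𝓘.2.1 F hF.1
    have := hs hx
    simp at this
  | succ n ih =>
    intro T hT Co
    set PW := (Finset.Icc 1 n).powerset with hPW
    set Q : Finset (MvPolynomial (Finset ℕ × Finset ℕ) ℚ)[X] :=
      (T ×ˢ (PW.powerset ×ˢ PW)).image (fun x => ∑ I ∈ x.2.1,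
        C (MvPolynomial.X (I, x.2.2) * MvPolynomial.C ((x.1 : ℚ) ^ (I.card - (x.2.2.card + 1)))) *
          X ^ (I.card - (x.2.2.card + 1))) with hQ
    obtain ⟨E, hE, hs⟩ := scale (n + 1) _ Q (T × PW → Fin r)
    obtain ⟨v', hv', hLC⟩ := ih ((T ×ˢ E).image (fun x => x.1 * x.2)) (by
      intro t ht
      obtain ⟨⟨a, b⟩, hx, rfl⟩ := Finset.mem_image.1 ht
      simp only [Finset.mem_product] at hx
      exact Nat.mul_pos (hT _ hx.1) (hE _ hx.2)) Co
    obtain ⟨e, he, b, hb, hq⟩ := hs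
      (MvPolynomial.eval (fun x => (∏ i ∈ x.1, v' i) / ∏ i ∈ x.2, v' i))
      (fun k x y => Co ((y.1.1 : ℚ) ^ (k + 1) * (∏ i ∈ y.2.1, v' i) * x))
    have he0 : (0 : ℚ) < e := by exact_mod_cast hE e he
    have hprod : ∀ I : Finset ℕ, (0 : ℚ) < ∏ i ∈ I, v' i := fun I =>
      Finset.prod_pos (fun i _ => hv' i)
    refine ⟨fun i => if i = n + 1 then e * b else e * v' i, ?_, ?_⟩
    · intro i
      dsimp only
      split_ifs
      · positivity
      · exact mul_pos he0 (hv' i)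
    intro t ht 𝓘 h𝓘 F hF hcard
    have hsmall : ∀ I : Finset ℕ, I ⊆ Finset.Icc 1 (n + 1) → n + 1 ∉ I → I ⊆ Finset.Icc 1 n := by
      intro I hI hn x hx
      have h1 := Finset.mem_Icc.1 (hI hx)
      have h2 : x ≠ n + 1 := fun h => hn (h ▸ hx)
      exact Finset.mem_Icc.2 ⟨h1.1, by omega⟩
    have hpr : ∀ I : Finset ℕ, n + 1 ∉ I →
        ∏ i ∈ I, (t : ℚ) * (if i = n + 1 then (e : ℚ) * b else e * v' i) =
          ∏ i ∈ I, ((t * e : ℕ) : ℚ) * v' i := by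
      intro I hI
      refine Finset.prod_congr rfl (fun i hi => ?_)
      have : i ≠ n + 1 := fun h => hI (h ▸ hi)
      rw [if_neg this]; push_cast; ring
    by_cases hnF : n + 1 ∈ F
    · -- new families
      set G := F.erase (n + 1) with hG
      have hFs := (h𝓘.2.1 F hF.1).2
      have hGs : G ⊆ Finset.Icc 1 n := hsmall G ((Finset.erase_subset _ _).trans hFs)
        (Finset.notMem_erase _ _)
      have hGc : G.card + 1 = F.card := Finset.card_erase_add_one hnF
      have hGn : G.card < n + 1 := by
        have := Finset.card_le_card hGs
        simp at this; omega
      have hIn : ∀ I ∈ 𝓘.erase F, n + 1 ∉ I := by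
        intro I hI hn
        have hI' := Finset.mem_erase.1 hI
        exact Finset.disjoint_left.1 (h𝓘.2.2 I hI'.2 F hF.1 hI'.1) hn hnF
      have hIs : ∀ I ∈ 𝓘.erase F, I ⊆ Finset.Icc 1 n := fun I hI =>
        hsmall I (h𝓘.2.1 I (Finset.mem_of_mem_erase hI)).2 (hIn I hI)
      have hmemG : G ∈ PW := Finset.mem_powerset.2 hGs
      have hmemJ : 𝓘.erase F ∈ PW.powerset :=
        Finset.mem_powerset.2 (fun I hI => Finset.mem_powerset.2 (hIs I hI))
      have key := (hq _ (Finset.mem_image.2 ⟨(t, 𝓘.erase F, G), by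
        simp only [Finset.mem_product]; exact ⟨ht, hmemJ, hmemG⟩, rfl⟩)).2 G.card hGn
      have key2 := congrFun key (⟨t, ht⟩, ⟨G, hmemG⟩)
      simp only [eval₂_finsetSum, eval₂_mul, eval₂_C, eval₂_pow, eval₂_X, map_mul,
        MvPolynomial.eval_X, MvPolynomial.eval_C] at key2
      have hF' : ∏ i ∈ F, (t : ℚ) * (if i = n + 1 then (e : ℚ) * b else e * v' i) =
          (t : ℚ) ^ (G.card + 1) * (∏ i ∈ G, v' i) * ((e : ℚ) ^ (G.card + 1) * b) := by
        rw [← Finset.mul_prod_erase F _ hnF, hpr _ (Finset.notMem_erase _ _), if_pos rfl,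
          Finset.prod_mul_distrib, Finset.prod_const, ← hG]
        push_cast; ring
      have hphi : phi 𝓘 (fun i => (t : ℚ) * (if i = n + 1 then (e : ℚ) * b else e * v' i)) =
          (t : ℚ) ^ (G.card + 1) * (∏ i ∈ G, v' i) * ((e : ℚ) ^ (G.card + 1) * (b +
            ∑ I ∈ 𝓘.erase F, (∏ i ∈ I, v' i) / (∏ i ∈ G, v' i) *
              (t : ℚ) ^ (I.card - (G.card + 1)) * (e : ℚ) ^ (I.card - (G.card + 1)))) := by
        unfold phi
        rw [← Finset.add_sum_erase 𝓘 _ hF.1, hF', mul_add, mul_add, Finset.mul_sum,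
          Finset.mul_sum]
        congr 1
        refine Finset.sum_congr rfl (fun I hI => ?_)
        rw [hpr I (hIn I hI), Finset.prod_mul_distrib, Finset.prod_const]
        have hc : G.card + 1 ≤ I.card := hGc ▸ hcard I (Finset.mem_of_mem_erase hI)
        obtain ⟨m, hm⟩ := Nat.exists_eq_add_of_le hc
        rw [hm, Nat.add_sub_cancel_left]
        have := (hprod G).ne'
        push_cast
        field_simp
        ring
      dsimp only
      rw [hphi, hF']
      exact key2
    · -- old families
      have hFs : F ⊆ Finset.Icc 1 n := hsmall F (h𝓘.2.1 F hF.1).2 hnF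
      have hIn : ∀ I ∈ 𝓘, n + 1 ∉ I := by
        intro I hI hn
        have hne : I ≠ F := fun h => hnF (h ▸ hn)
        have h1 := hF.2 I hI hne
        have h2 : ((n + 1 : ℕ) : WithBot ℕ) ≤ I.max := Finset.le_max hn
        have h3 : F.max ≤ ((n : ℕ) : WithBot ℕ) := Finset.max_le (fun a ha =>
          WithBot.coe_le_coe.2 (Finset.mem_Icc.1 (hFs ha)).2)
        have h4 : ((n + 1 : ℕ) : WithBot ℕ) < ((n : ℕ) : WithBot ℕ) :=
          lt_of_le_of_lt h2 (lt_of_lt_of_le h1 h3)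
        have h5 : n + 1 < n := by exact_mod_cast h4
        omega
      have hfam : IsNFamily n 𝓘 := ⟨h𝓘.1, fun I hI => ⟨(h𝓘.2.1 I hI).1,
        hsmall I (h𝓘.2.1 I hI).2 (hIn I hI)⟩, h𝓘.2.2⟩
      have := hLC (t * e) (Finset.mem_image.2 ⟨(t, e), by simp [ht, he], rfl⟩) 𝓘 hfam F hF hcard
      dsimp only
      rw [hpr F hnF]
      unfold phi at this ⊢
      rw [Finset.sum_congr rfl (fun I hI => hpr I (hIn I hI))]
      exact this

end helpers

/-- For all positive `r`, `n` there is a finite set `S` of positive rationals such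
that for every `r`-coloring `C` of `S` there is `v ∈ Sⁿ` such that for every
`n`-family `𝓘` with `|f(𝓘)| ≤ |I'|` for all `I' ∈ 𝓘`, both `φ_𝓘(v)` and
`Π_{i ∈ f(𝓘)} v i` lie in `S` and get the same color. -/
theorem lower_consistent_vector_exists (r n : ℕ) (hr : 0 < r) (hn : 0 < n) :
    ∃ S : Finset ℚ, (∀ s ∈ S, 0 < s) ∧
      ∀ C : ℚ → Fin r,
        ∃ v : ℕ → ℚ, (∀ i ∈ Finset.Icc 1 n, v i ∈ S) ∧
          ∀ 𝓘 : Finset (Finset ℕ), IsNFamily n 𝓘 →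
            ∀ F : Finset ℕ, IsLeading 𝓘 F →
              (∀ I' ∈ 𝓘, F.card ≤ I'.card) →
              phi 𝓘 v ∈ S ∧ (∏ i ∈ F, v i) ∈ S ∧
                C (phi 𝓘 v) = C (∏ i ∈ F, v i) := by
  classical
  -- compactness of the space of colorings
  set U : {v : ℕ → ℚ // ∀ i, 0 < v i} → Set (ℚ → Fin r) := fun v => {Co | LC n Co v.1} with hU
  have hfin : ∀ 𝓘, IsNFamily n 𝓘 → 𝓘 ∈ ((Finset.Icc 1 n).powerset).powerset := fun 𝓘 h =>
    Finset.mem_powerset.2 (fun I hI => Finset.mem_powerset.2 (h.2.1 I hI).2)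
  have hopen : ∀ v, IsOpen (U v) := by
    intro v
    have hUe : U v = ⋂ x ∈ ((((Finset.Icc 1 n).powerset).powerset ×ˢ (Finset.Icc 1 n).powerset).filter
        (fun x => IsNFamily n x.1 ∧ IsLeading x.1 x.2 ∧ ∀ I' ∈ x.1, x.2.card ≤ I'.card) :
          Finset (Finset (Finset ℕ) × Finset ℕ)),
        {Co : ℚ → Fin r | Co (phi x.1 v.1) = Co (∏ i ∈ x.2, v.1 i)} := by
      ext Co
      simp only [hU, LC, Set.mem_setOf_eq, Set.mem_iInter, Finset.mem_filter, Finset.mem_product]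
      constructor
      · rintro h ⟨𝓘, F⟩ ⟨_, h1, h2, h3⟩
        exact h 𝓘 h1 F h2 h3
      · intro h 𝓘 h1 F h2 h3
        exact h (𝓘, F) ⟨⟨hfin 𝓘 h1, Finset.mem_powerset.2 (h1.2.1 F h2.1).2⟩, h1, h2, h3⟩
    rw [hUe]
    refine isOpen_biInter_finset (fun x _ => ?_)
    have hcont : Continuous (fun Co : ℚ → Fin r => (Co (phi x.1 v.1), Co (∏ i ∈ x.2, v.1 i))) := by
      fun_prop
    exact (isOpen_discrete {p : Fin r × Fin r | p.1 = p.2}).preimage hcont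
  have hcover : (Set.univ : Set (ℚ → Fin r)) ⊆ ⋃ v, U v := by
    intro Co _
    obtain ⟨v, hv, hL⟩ := exists_LC r n {1} (by simp) Co
    refine Set.mem_iUnion.2 ⟨⟨v, hv⟩, ?_⟩
    have h := hL 1 (by simp)
    simp only [Nat.cast_one, one_mul] at h
    exact h
  obtain ⟨W, hW⟩ := isCompact_univ.elim_finite_subcover U hopen hcover
  set S : Finset ℚ := (W.biUnion (fun v => (((Finset.Icc 1 n).powerset).powerset).image
        (fun 𝓘 => phi 𝓘 v.1))).filter (fun s => 0 < s) with hS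
  have hmemS : ∀ v ∈ W, ∀ 𝓘 ∈ ((Finset.Icc 1 n).powerset).powerset, 0 < phi 𝓘 v.1 →
      phi 𝓘 v.1 ∈ S := by
    intro v hv 𝓘 h𝓘 hpos
    exact Finset.mem_filter.2 ⟨Finset.mem_biUnion.2 ⟨v, hv, Finset.mem_image_of_mem _ h𝓘⟩, hpos⟩
  refine ⟨S, fun s hs => (Finset.mem_filter.1 hs).2, fun Co => ?_⟩
  obtain ⟨v, hv, hCo⟩ := Set.mem_iUnion₂.1 (hW (Set.mem_univ Co))
  have hsing : ∀ F ⊆ Finset.Icc 1 n, ∏ i ∈ F, v.1 i ∈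
      S := by
    intro F hF
    have he : phi {F} v.1 = ∏ i ∈ F, v.1 i := by simp [phi]
    rw [← he]
    refine hmemS v hv {F} (by simpa using hF) ?_
    rw [he]
    exact Finset.prod_pos (fun i _ => v.2 i)
  refine ⟨v.1, fun i hi => ?_, fun 𝓘 h𝓘 F hF hc => ⟨hmemS v hv 𝓘 (hfin 𝓘 h𝓘) ?_, ?_, ?_⟩⟩
  · simpa using hsing {i} (by simpa using hi)
  · exact Finset.sum_pos (fun I _ => Finset.prod_pos (fun i _ => v.2 i)) h𝓘.1
  · exact hsing F (h𝓘.2.1 F hF.1).2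
  · exact hCo 𝓘 h𝓘 F hF hc
end

section
/- (Stable extension) Let 𝔛 be a collection of new n-families such that |A| > |B| for every (A,B) ∈ newp(𝔛). Then for every positive integer r and every finite set Q ⊆ ℚ₊, there exist finite sets D ⊆ ℕ, Q' ⊆ ℚ₊ and Λ ⊆ ℚ_{≥0}^{newp(𝔛)} such that: for every u ∈ ℚ₊^{n−1}, every x ∈ ℚ₊ and every coloring C : ℚ₊ → {1,…,r}, there exist d ∈ D, q' ∈ Q' and λ ∈ Λ such that, setting x' := q'·(x + Σ_{(A,B)∈newp(𝔛)} λ_{(A,B)}·(Π_{a∈A} u_a)/(Π_{b∈B} u_b)) and v := (d·u₁,…,d·u_{n−1}, x'), the vector q·v is 𝔛-consistent with respect to C for every q ∈ Q. -/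
/-- The ratio `(Π_{a ∈ A} u a) / (Π_{b ∈ B} u b)` associated to a pair `(A, B)`. -/
def ratio (u : ℕ → ℚ) (AB : Finset ℕ × Finset ℕ) : ℚ :=
  (∏ a ∈ AB.1, u a) / (∏ b ∈ AB.2, u b)

/-- `newp(𝔛)`: the pairs `(A, B)` of subsets of `[n-1]` such that `A` and
`B ∪ {n}` are distinct members of a common family `𝓘 ∈ 𝔛`. -/
def newp (n : ℕ) (𝔛 : Set (Finset (Finset ℕ))) : Set (Finset ℕ × Finset ℕ) :=
  {AB | AB.1 ⊆ Finset.Icc 1 (n - 1) ∧ AB.2 ⊆ Finset.Icc 1 (n - 1) ∧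
    ∃ 𝓘 ∈ 𝔛, AB.1 ∈ 𝓘 ∧ AB.2 ∪ {n} ∈ 𝓘 ∧ AB.1 ≠ AB.2 ∪ {n}}

open scoped Classical in
/-- `newp(𝔛)` as a finite set (it consists of pairs of subsets of `[n-1]`). -/
noncomputable def newpF (n : ℕ) (𝔛 : Set (Finset (Finset ℕ))) :
    Finset (Finset ℕ × Finset ℕ) :=
  ((Finset.Icc 1 (n - 1)).powerset ×ˢ (Finset.Icc 1 (n - 1)).powerset).filter
    (fun AB => AB ∈ newp n 𝔛)

namespace SE

/-- shifted function vanishing at zero -/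
def sh {G : Type} [AddCommGroup G] (h : ℕ) (f : ℕ → G) : ℕ → G := fun x => f (x + h) - f h

/-- partition-regularity property for a finite family of functions -/
def Good {G : Type} [AddCommGroup G] (A : Finset (ℕ → G)) : Prop :=
  ∀ (κ : Type) [Fintype κ], ∃ (D : Finset ℕ) (S : Finset G), (∀ d ∈ D, 0 < d) ∧
    ∀ C : G → κ, ∃ a ∈ S, ∃ d ∈ D, ∀ f ∈ A, C (a + f d) = C a

open scoped Classical in
theorem good_step {G : Type} [AddCommGroup G] (A : Finset (ℕ → G)) (p : ℕ → G)
    (h0 : ∀ f ∈ A, f 0 = 0)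
    (H : ∀ H : Finset ℕ, Good ((A ×ˢ H).image (fun z => sh z.2 z.1 - p))) : Good A := by
  intro κ _
  have key : ∀ k : ℕ, ∃ (D : Finset ℕ) (S : Finset G), (∀ d ∈ D, 0 < d) ∧
      ∀ C : G → κ, (∃ a ∈ S, ∃ d ∈ D, ∀ f ∈ A, C (a + f d) = C a) ∨
        ∃ a ∈ S, ∃ T : Finset κ, T.card = k ∧ C a ∉ T ∧
          ∀ c ∈ T, ∃ d ∈ D, ∀ f ∈ A, C (a + f d) = c := by
    intro k
    induction k with
    | zero =>
      refine ⟨∅, {0}, by simp, fun C => Or.inr ⟨0, by simp, ∅, by simp⟩⟩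
    | succ k ih =>
      obtain ⟨D, S, hD, hC⟩ := ih
      let W : Finset G := S ∪ (S ×ˢ (A ×ˢ D)).image (fun z => z.1 + z.2.1 z.2.2)
      obtain ⟨D', S', hD', hC'⟩ := H (insert 0 D) (W → κ)
      refine ⟨D ∪ (D' ×ˢ (insert 0 D)).image (fun z => z.1 + z.2),
        (S' ×ˢ S).image (fun z => z.1 + z.2) ∪
        (S' ×ˢ (S ×ˢ D')).image (fun z => z.1 + z.2.1 - p z.2.2), ?_, ?_⟩
      · intro d hd
        rcases Finset.mem_union.1 hd with hd | hd
        · exact hD d hd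
        · obtain ⟨z, hz, rfl⟩ := Finset.mem_image.1 hd
          have := hD' z.1 (Finset.mem_product.1 hz).1
          show 0 < z.1 + z.2
          omega
      intro C
      obtain ⟨b, hb, x, hx, hbx⟩ := hC' (fun g w => C (g + w))
      have hW : ∀ w ∈ W, ∀ f ∈ A, ∀ h ∈ insert 0 D,
          C (b + w + (f (x + h) - f h - p x)) = C (b + w) := by
        intro w hw f hf h hh
        have := congrFun (hbx (sh h f - p)
          (Finset.mem_image.2 ⟨(f, h), Finset.mem_product.2 ⟨hf, hh⟩, rfl⟩)) ⟨w, hw⟩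
        simp only [Pi.sub_apply, sh] at this
        rw [← this]; congr 1; abel
      rcases hC (fun g => C (b + g)) with ⟨a, ha, d, hd, h⟩ | ⟨a, ha, T, hT, haT, h⟩
      · left
        refine ⟨b + a, Finset.mem_union_left _ (Finset.mem_image.2 ⟨(b, a), by simp [hb, ha], rfl⟩),
          d, Finset.mem_union_left _ hd, fun f hf => ?_⟩
        rw [add_assoc]; exact h f hf
      · have hS'' : b + a - p x ∈ (S' ×ˢ S).image (fun z => z.1 + z.2) ∪
            (S' ×ˢ (S ×ˢ D')).image (fun z => z.1 + z.2.1 - p z.2.2) :=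
          Finset.mem_union_right _ (Finset.mem_image.2 ⟨(b, a, x), by simp [hb, ha, hx], rfl⟩)
        have main : ∀ c ∈ insert (C (b + a)) T,
            ∃ d ∈ D ∪ (D' ×ˢ (insert 0 D)).image (fun z => z.1 + z.2),
              ∀ f ∈ A, C (b + a - p x + f d) = c := by
          intro c hc
          rcases Finset.mem_insert.1 hc with rfl | hc
          · refine ⟨x + 0, Finset.mem_union_right _ (Finset.mem_image.2 ⟨(x, 0), by simp [hx], rfl⟩),
              fun f hf => ?_⟩
            rw [← hW a (Finset.mem_union_left _ ha) f hf 0 (by simp), h0 f hf]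
            congr 1; abel
          · obtain ⟨d, hd, hcd⟩ := h c hc
            refine ⟨x + d, Finset.mem_union_right _ (Finset.mem_image.2 ⟨(x, d), by simp [hx, hd], rfl⟩),
              fun f hf => ?_⟩
            rw [← hcd f hf, ← hW (a + f d) (Finset.mem_union_right _ (Finset.mem_image.2
              ⟨(a, f, d), by simp [ha, hf, hd], rfl⟩)) f hf d (by simp [hd])]
            congr 1; abel
        by_cases hin : C (b + a - p x) ∈ insert (C (b + a)) T
        · left
          obtain ⟨d, hd, hcd⟩ := main _ hin
          exact ⟨_, hS'', d, hd, hcd⟩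
        · right
          exact ⟨_, hS'', _, by rw [Finset.card_insert_of_notMem haT, hT], hin, main⟩
  obtain ⟨D, S, hD, hC⟩ := key (Fintype.card κ + 1)
  refine ⟨D, S, hD, fun C => ?_⟩
  rcases hC C with h | ⟨a, ha, T, hT, -⟩
  · exact h
  · have := Finset.card_le_univ T
    omega

/-- polynomial maps of degree at most `e` vanishing at zero -/
def V (G : Type) [AddCommGroup G] : ℕ → Set (ℕ → G)
  | 0 => {0}
  | e + 1 => {f | f 0 = 0 ∧ ∀ h, sh h f - f ∈ V G e}

section
variable {G : Type} [AddCommGroup G]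

theorem V_zero_mem (e : ℕ) : (0 : ℕ → G) ∈ V G e := by
  induction e with
  | zero => simp [V]
  | succ e ih =>
    refine ⟨rfl, fun h => ?_⟩
    have : sh h (0 : ℕ → G) - 0 = 0 := by ext; simp [sh]
    rw [this]; exact ih

theorem V_sub {e : ℕ} {f g : ℕ → G} (hf : f ∈ V G e) (hg : g ∈ V G e) : f - g ∈ V G e := by
  induction e generalizing f g with
  | zero =>
    simp only [V, Set.mem_singleton_iff] at *
    rw [hf, hg, sub_zero]
  | succ e ih =>
    refine ⟨by simp [hf.1, hg.1], fun h => ?_⟩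
    have : sh h (f - g) - (f - g) = (sh h f - f) - (sh h g - g) := by
      ext; simp [sh]; abel
    rw [this]; exact ih (hf.2 h) (hg.2 h)

theorem V_neg {e : ℕ} {f : ℕ → G} (hf : f ∈ V G e) : -f ∈ V G e := by
  rw [← zero_sub]; exact V_sub (V_zero_mem e) hf

theorem V_add {e : ℕ} {f g : ℕ → G} (hf : f ∈ V G e) (hg : g ∈ V G e) : f + g ∈ V G e := by
  rw [← sub_neg_eq_add]; exact V_sub hf (V_neg hg)

theorem V_succ {e : ℕ} {f : ℕ → G} (hf : f ∈ V G e) : f ∈ V G (e + 1) := by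
  induction e generalizing f with
  | zero =>
    simp only [V, Set.mem_singleton_iff] at hf
    rw [hf]; exact V_zero_mem _
  | succ e ih => exact ⟨hf.1, fun h => ih (hf.2 h)⟩

theorem V_mono {e e' : ℕ} (h : e ≤ e') {f : ℕ → G} (hf : f ∈ V G e) : f ∈ V G e' := by
  induction h with
  | refl => exact hf
  | step _ ih => exact V_succ ih

theorem V_apply_zero {e : ℕ} {f : ℕ → G} (hf : f ∈ V G e) : f 0 = 0 := (V_succ hf).1

theorem good_erase [DecidableEq (ℕ → G)] {A : Finset (ℕ → G)} (h : Good (A.erase 0)) : Good A := by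
  intro κ _
  obtain ⟨D, S, hD, hC⟩ := h κ
  refine ⟨D, S, hD, fun C => ?_⟩
  obtain ⟨a, ha, d, hd, h⟩ := hC C
  refine ⟨a, ha, d, hd, fun f hf => ?_⟩
  by_cases hf0 : f = 0
  · simp [hf0]
  · exact h f (Finset.mem_erase.2 ⟨hf0, hf⟩)

theorem good_empty : Good (∅ : Finset (ℕ → G)) := by
  intro κ _
  exact ⟨{1}, {0}, by simp, fun C => ⟨0, by simp, 1, by simp, by simp⟩⟩

/-- level `i : Fin E` stands for degree `i+1` -/
def Cov {E : ℕ} (R : Fin E → Finset (ℕ → G)) (f : ℕ → G) : Prop :=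
  ∃ i : Fin E, ∃ g ∈ R i, f ∈ V G (i + 1) ∧ f - g ∈ V G i

theorem exists_level {e : ℕ} {f : ℕ → G} (hf : f ∈ V G e) (h0 : f ≠ 0) :
    ∃ i < e, f ∈ V G (i + 1) ∧ f ∉ V G i := by
  induction e with
  | zero => exact absurd hf h0
  | succ e ih =>
    by_cases h : f ∈ V G e
    · obtain ⟨i, hi, h⟩ := ih h
      exact ⟨i, by omega, h⟩
    · exact ⟨e, by omega, hf, h⟩

open scoped Classical in
theorem good_cov {E : ℕ} (w : Fin E → ℕ) : ∀ (R : Fin E → Finset (ℕ → G)) (A : Finset (ℕ → G)),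
    (∀ i, (R i).card = w i) → (∀ f ∈ A, f ≠ 0 → Cov R f) → Good A := by
  have wf : WellFounded (Pi.Lex (fun i j : Fin E => j < i) (fun {_} (a b : ℕ) => a < b)) :=
    Pi.Lex.wellFounded _ (fun _ => wellFounded_lt)
  induction w using wf.induction with
  | _ w ih =>
  intro R A hw hA
  apply good_erase
  set A₀ := A.erase 0 with hA₀
  have hA' : ∀ f ∈ A₀, Cov R f := fun f hf =>
    hA f (Finset.mem_erase.1 hf).2 (Finset.mem_erase.1 hf).1
  clear_value A₀
  rcases A₀.eq_empty_or_nonempty with rfl | ⟨f₀, hf₀⟩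
  · exact good_empty
  have hex : ∃ i : ℕ, ∃ hi : i < E, ∃ p ∈ A₀, ∃ g ∈ R ⟨i, hi⟩, p ∈ V G (i + 1) ∧ p - g ∈ V G i := by
    obtain ⟨i, g, hg, h⟩ := hA' f₀ hf₀
    exact ⟨i, i.2, f₀, hf₀, g, hg, h⟩
  -- minimal level at which a member of the family is covered
  obtain ⟨i, ⟨hi, p, hp, g, hg, hpV, hpg⟩, hmin⟩ :
      ∃ i : ℕ, (∃ hi : i < E, ∃ p ∈ A₀, ∃ g ∈ R ⟨i, hi⟩, p ∈ V G (i + 1) ∧ p - g ∈ V G i) ∧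
        ∀ m < i, ¬ ∃ hi : m < E, ∃ p ∈ A₀, ∃ g ∈ R ⟨m, hi⟩, p ∈ V G (m + 1) ∧ p - g ∈ V G m :=
    ⟨Nat.find hex, Nat.find_spec hex, fun m hm => Nat.find_min hex hm⟩
  have h00 : ∀ f ∈ A₀, f 0 = 0 := fun f hf => by
    obtain ⟨i, g, hg, h, -⟩ := hA' f hf
    exact V_apply_zero h
  apply good_step A₀ p h00
  intro H
  set A₁ := (A₀ ×ˢ H).image (fun z => sh z.2 z.1 - p) with hA₁
  let R' : Fin E → Finset (ℕ → G) := fun j =>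
    if i < j then R j else if (j : ℕ) = i then ((R j).erase g).image (fun g' => g' - g) else A₁
  refine ih (fun j => (R' j).card) ⟨⟨i, hi⟩, ?_, ?_⟩ R' A₁ (fun _ => rfl) ?_
  · intro j hj
    have : i < (j : ℕ) := hj
    simp [R', this, hw]
  · simp only [R', lt_irrefl, if_false, if_true]
    refine lt_of_le_of_lt Finset.card_image_le ?_
    rw [← hw]
    exact Finset.card_erase_lt_of_mem hg
  intro f hf hf0
  obtain ⟨⟨q, h⟩, hqh, rfl⟩ := Finset.mem_image.1 hf
  obtain ⟨hq, hh⟩ := Finset.mem_product.1 hqh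
  simp only at *
  obtain ⟨j, g', hg', hqV, hqg⟩ := hA' q hq
  have hji : i ≤ j := by
    by_contra hlt
    exact hmin j (by omega) ⟨j.2, q, hq, g', hg', hqV, hqg⟩
  rcases hji.lt_or_eq with hlt | heq
  · refine ⟨j, g', by simp [R', hlt, hg'], ?_, ?_⟩
    · have : sh h q - p = (sh h q - q) + (q - p) := by abel
      rw [this]
      exact V_add (V_succ (hqV.2 h)) (V_sub hqV (V_mono (by omega) hpV))
    · have : sh h q - p - g' = (sh h q - q) + (q - g') - p := by abel
      rw [this]
      exact V_sub (V_add (hqV.2 h) hqg) (V_mono (by omega) hpV)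
  · obtain ⟨j, hj⟩ := j
    simp only at heq
    subst heq
    by_cases hgg : g' = g
    · subst hgg
      have hV : sh h q - p ∈ V G i := by
        have : sh h q - p = (sh h q - q) + (q - g') - (p - g') := by abel
        rw [this]
        exact V_sub (V_add (hqV.2 h) hqg) hpg
      obtain ⟨l, hl, hlV, -⟩ := exists_level hV hf0
      refine ⟨⟨l, by omega⟩, sh h q - p, ?_, hlV, ?_⟩
      · have h1 : ¬ i < l := by omega
        have h2 : l ≠ i := by omega
        simp only [R', h1, h2, if_false]
        exact hf
      · rw [sub_self]; exact V_zero_mem _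
    · refine ⟨⟨i, hj⟩, g' - g, ?_, ?_, ?_⟩
      · simp only [R', lt_irrefl, if_false, if_true]
        exact Finset.mem_image.2 ⟨g', Finset.mem_erase.2 ⟨hgg, hg'⟩, rfl⟩
      · have : sh h q - p = (sh h q - q) + (q - p) := by abel
        rw [this]
        exact V_add (V_succ (hqV.2 h)) (V_sub hqV hpV)
      · have : sh h q - p - (g' - g) = (sh h q - q) + (q - g') - (p - g) := by abel
        rw [this]
        exact V_sub (V_add (hqV.2 h) hqg) hpg

/-- polynomial van der Waerden -/
theorem good_of_V (E : ℕ) (A : Finset (ℕ → G)) (hA : ∀ f ∈ A, f ∈ V G E) : Good A := by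
  refine good_cov (fun _ : Fin E => A.card) (fun _ => A) A (fun _ => rfl) ?_
  intro f hf h0
  obtain ⟨i, hi, h, -⟩ := exists_level (hA f hf) h0
  exact ⟨⟨i, hi⟩, f, hf, h, by rw [sub_self]; exact V_zero_mem _⟩

end

theorem V_pi {ι : Type} (e : ℕ) (f : ℕ → ι → ℚ) (h : ∀ i, (fun s => f s i) ∈ V ℚ e) :
    f ∈ V (ι → ℚ) e := by
  induction e generalizing f with
  | zero =>
    simp only [V, Set.mem_singleton_iff] at *
    ext s i
    exact congrFun (h i) s
  | succ e ih =>
    refine ⟨?_, fun k => ih _ fun i => (h i).2 k⟩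
    ext i; exact (h i).1

theorem V_sum {α : Type} (e : ℕ) (t : Finset α) (f : α → ℕ → ℚ) (h : ∀ i ∈ t, f i ∈ V ℚ e) :
    ∑ i ∈ t, f i ∈ V ℚ e := by
  classical
  induction t using Finset.induction_on with
  | empty => simpa using V_zero_mem e
  | insert a t ha ih =>
    rw [Finset.sum_insert ha]
    exact V_add (h a (by simp)) (ih fun i hi => h i (by simp [hi]))

theorem V_pow (e : ℕ) : ∀ c : ℚ, (fun s : ℕ => (s : ℚ) ^ (e + 1) * c) ∈ V ℚ (e + 1) := by
  induction e using Nat.strong_induction_on with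
  | _ e ih =>
  intro c
  refine ⟨by simp, fun h => ?_⟩
  have : sh h (fun s : ℕ => (s : ℚ) ^ (e + 1) * c) - (fun s : ℕ => (s : ℚ) ^ (e + 1) * c) =
      ∑ m ∈ Finset.range e, fun s : ℕ => (s : ℚ) ^ (m + 1) *
        ((h : ℚ) ^ (e - m) * ((e + 1).choose (m + 1) : ℚ) * c) := by
    ext s
    simp only [Pi.sub_apply, sh, Finset.sum_apply]
    push_cast
    rw [add_pow, Finset.sum_range_succ, Finset.sum_range_succ']
    simp only [Nat.add_sub_add_right]
    simp only [← mul_assoc, ← Finset.sum_mul]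
    simp
    ring
  rw [this]
  refine V_sum _ _ _ fun m hm => ?_
  have hm := Finset.mem_range.1 hm
  exact V_mono (by omega) (ih m hm _)

/-- evaluation of a coefficient vector at scale `d` along directions `ρ` -/
def ev {ι : Type} {E : ℕ} (P : Finset ι) (ρ : ι → ℚ) (d : ℚ) (k : ι × Fin E → ℚ) : ℚ :=
  ∑ i ∈ P, (∑ m : Fin E, d ^ ((m : ℕ) + 1) * k (i, m)) * ρ i

theorem ev_add {ι : Type} {E : ℕ} (P : Finset ι) (ρ : ι → ℚ) (d : ℚ) (k k' : ι × Fin E → ℚ) :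
    ev P ρ d (k + k') = ev P ρ d k + ev P ρ d k' := by
  simp only [ev, Pi.add_apply, mul_add, Finset.sum_add_distrib, add_mul]

/-- rescaled coefficient vector -/
def rs {ι : Type} {E : ℕ} (b : ℕ) (k : ι × Fin E → ℚ) (s : ℕ) : ι × Fin E → ℚ :=
  fun z => (s : ℚ) ^ (b + (z.2 : ℕ) + 1) * k z

theorem ev_rs {ι : Type} {E : ℕ} (P : Finset ι) (ρ : ι → ℚ) (d : ℚ) (k : ι × Fin E → ℚ)
    (b s : ℕ) : ev P ρ d (rs b k s) = (s : ℚ) ^ b * ev P ρ (s * d) k := by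
  simp only [ev, rs, Finset.mul_sum]
  refine Finset.sum_congr rfl fun i _ => ?_
  rw [← mul_assoc, Finset.mul_sum]
  congr 1
  refine Finset.sum_congr rfl fun m _ => ?_
  ring

theorem good_rs {ι : Type} {E : ℕ} [DecidableEq (ℕ → ι × Fin E → ℚ)] (b : ℕ)
    (K : Finset (ι × Fin E → ℚ)) :
    Good (K.image (rs b)) := by
  refine good_of_V (b + E) _ fun f hf => ?_
  obtain ⟨k, hk, rfl⟩ := Finset.mem_image.1 hf
  refine V_pi _ _ fun z => ?_
  exact V_mono (by have := z.2.2; omega) (V_pow (b + z.2) (k z))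

open scoped Classical in
theorem stage {ι : Type} {E : ℕ} (P : Finset ι) (κ : Type) [Fintype κ] (b : ℕ) :
    ∀ (M : Finset ℚ) (K : Finset (ι × Fin E → ℚ)),
    ∃ (D : Finset ℕ) (Q' : Finset ℚ) (Λ : Finset (ι → ℚ)),
      (∀ d ∈ D, 0 < d) ∧ (∀ q ∈ Q', 0 < q) ∧
      ∀ (ρ : ι → ℚ) (x : ℚ) (χ : ℚ → κ), ∃ d ∈ D, ∃ q ∈ Q', ∃ l ∈ Λ,
        ∀ b' < b, ∀ m ∈ M, ∀ k ∈ K,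
          χ (m * (d : ℚ) ^ b' * (q * (x + ∑ i ∈ P, l i * ρ i) + ev P ρ d k)) =
          χ (m * (d : ℚ) ^ b' * (q * (x + ∑ i ∈ P, l i * ρ i))) := by
  induction b with
  | zero =>
    intro M K
    exact ⟨{1}, {1}, {0}, by simp, by simp, fun ρ x χ => ⟨1, by simp, 1, by simp, 0, by simp,
      fun b' hb' => absurd hb' (by omega)⟩⟩
  | succ b ih =>
    intro M K
    obtain ⟨Dp, Sp, hDp, hp⟩ := good_rs b K (M → κ)
    obtain ⟨D, Q', Λ, hD, hQ', h⟩ := ih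
      ((M ×ˢ (Dp ×ˢ Finset.range b)).image
        (fun z => z.1 * (z.2.1 : ℚ) ^ z.2.2 * ((z.2.1 : ℚ) ^ b)⁻¹))
      (Sp ∪ (Sp ×ˢ (Dp ×ˢ K)).image (fun z => z.1 + rs b z.2.2 z.2.1))
    refine ⟨(Dp ×ˢ D).image (fun z => z.1 * z.2),
      (Dp ×ˢ Q').image (fun z => ((z.1 : ℚ) ^ b)⁻¹ * z.2),
      ((Λ ×ˢ Q') ×ˢ (D ×ˢ Sp)).image (fun z => fun i => z.1.1 i +
        z.1.2⁻¹ * ∑ m : Fin E, (z.2.1 : ℚ) ^ ((m : ℕ) + 1) * z.2.2 (i, m)), ?_, ?_, ?_⟩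
    · intro d hd
      obtain ⟨z, hz, rfl⟩ := Finset.mem_image.1 hd
      obtain ⟨h1, h2⟩ := Finset.mem_product.1 hz
      exact Nat.mul_pos (hDp _ h1) (hD _ h2)
    · intro d hd
      obtain ⟨z, hz, rfl⟩ := Finset.mem_image.1 hd
      obtain ⟨h1, h2⟩ := Finset.mem_product.1 hz
      have := hDp _ h1
      have := hQ' _ h2
      positivity
    intro ρ x χ
    obtain ⟨d, hd, q, hq, l, hl, hh⟩ := h ρ x χ
    set x₀ := q * (x + ∑ i ∈ P, l i * ρ i) with hx₀
    obtain ⟨a, ha, s, hs, has⟩ := hp (fun g m => χ (m * (d : ℚ) ^ b * (x₀ + ev P ρ d g)))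
    have hs0 : (s : ℚ) ≠ 0 := by have := hDp s hs; positivity
    have hq0 : q ≠ 0 := (hQ' q hq).ne'
    refine ⟨s * d, Finset.mem_image.2 ⟨(s, d), by simp [hs, hd], rfl⟩,
      ((s : ℚ) ^ b)⁻¹ * q, Finset.mem_image.2 ⟨(s, q), by simp [hs, hq], rfl⟩, _,
      Finset.mem_image.2 ⟨((l, q), (d, a)), by simp [hl, hq, hd, ha], rfl⟩, ?_⟩
    have hx1 : ((s : ℚ) ^ b)⁻¹ * q * (x + ∑ i ∈ P, (l i +
        q⁻¹ * ∑ m : Fin E, (d : ℚ) ^ ((m : ℕ) + 1) * a (i, m)) * ρ i) =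
        ((s : ℚ) ^ b)⁻¹ * (x₀ + ev P ρ d a) := by
      rw [mul_assoc]
      congr 1
      simp only [add_mul, Finset.sum_add_distrib, mul_assoc, ← Finset.mul_sum]
      rw [hx₀, ev]
      field_simp
      ring
    simp only
    rw [hx1]
    intro b' hb' m hm k hk
    have hx2 : ((s : ℚ) ^ b)⁻¹ * (x₀ + ev P ρ d a) + ev P ρ ((s * d : ℕ) : ℚ) k =
        ((s : ℚ) ^ b)⁻¹ * (x₀ + ev P ρ d (a + rs b k s)) := by
      rw [ev_add, ev_rs]
      push_cast
      field_simp
      ring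
    rw [hx2]
    push_cast
    rcases Nat.lt_succ_iff_lt_or_eq.1 hb' with hlt | rfl
    · have hmem : m * (s : ℚ) ^ b' * ((s : ℚ) ^ b)⁻¹ ∈ (M ×ˢ (Dp ×ˢ Finset.range b)).image
        (fun z => z.1 * (z.2.1 : ℚ) ^ z.2.2 * ((z.2.1 : ℚ) ^ b)⁻¹) :=
        Finset.mem_image.2 ⟨(m, s, b'), by simp [hm, hs, hlt], rfl⟩
      have e1 := hh b' hlt _ hmem a (Finset.mem_union_left _ ha)
      have e2 := hh b' hlt _ hmem (a + rs b k s) (Finset.mem_union_right _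
        (Finset.mem_image.2 ⟨(a, s, k), by simp [ha, hs, hk], rfl⟩))
      have e3 := e2.trans e1.symm
      convert e3 using 2 <;> ring
    · have e := congrFun (has (rs b' k) (Finset.mem_image_of_mem _ hk)) ⟨m, hm⟩
      simp only at e
      convert e using 2 <;> (field_simp; ring)

/-- coefficient vector of a family with leading set `F` -/
def kv (n : ℕ) (q : ℚ) (𝓘 : Finset (Finset ℕ)) (F : Finset ℕ) :
    (Finset ℕ × Finset ℕ) × Fin n → ℚ := fun z =>
  if z.1.1 ∈ 𝓘.erase F ∧ z.1.2 = F.erase n ∧ (z.2 : ℕ) + 1 + (F.erase n).card = z.1.1.card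
  then q ^ (z.2 : ℕ) else 0

theorem mem_newpF_iff (n : ℕ) (𝔛 : Set (Finset (Finset ℕ))) (AB : Finset ℕ × Finset ℕ) :
    AB ∈ newpF n 𝔛 ↔ AB ∈ newp n 𝔛 := by
  classical
  simp only [newpF, Finset.mem_filter, Finset.mem_product, Finset.mem_powerset]
  exact ⟨fun h => h.2, fun h => ⟨⟨h.1, h.2.1⟩, h⟩⟩

theorem sub_pred {n : ℕ} {A : Finset ℕ} (hA : A ⊆ Finset.Icc 1 n) (hn : n ∉ A) :
    A ⊆ Finset.Icc 1 (n - 1) := by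
  intro a ha
  have := Finset.mem_Icc.1 (hA ha)
  have : a ≠ n := fun h => hn (h ▸ ha)
  exact Finset.mem_Icc.2 (by omega)

section fin
variable {n : ℕ} {𝔛 : Set (Finset (Finset ℕ))} {𝓘 : Finset (Finset ℕ)} {F : Finset ℕ}

theorem pair_mem (hI : IsNFamily n 𝓘) (h𝓘 : 𝓘 ∈ 𝔛) (hF : F ∈ 𝓘) (hn : n ∈ F)
    {A : Finset ℕ} (hA : A ∈ 𝓘.erase F) : (A, F.erase n) ∈ newp n 𝔛 ∧ n ∉ A := by
  obtain ⟨hne, hA⟩ := Finset.mem_erase.1 hA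
  have hnA : n ∉ A := fun h => Finset.disjoint_left.1 (hI.2.2 A hA F hF hne) h hn
  have hB : F.erase n ∪ {n} = F := by
    ext a
    by_cases h : a = n
    · simp [h, hn]
    · simp [h]
  refine ⟨⟨sub_pred (hI.2.1 A hA).2 hnA,
    sub_pred ((Finset.erase_subset _ _).trans (hI.2.1 F hF).2) (by simp), 𝓘, h𝓘, hA, ?_, ?_⟩, hnA⟩
  · simpa only [hB] using hF
  · simpa only [hB] using hne

theorem ev_kv (hI : IsNFamily n 𝓘) (h𝓘 : 𝓘 ∈ 𝔛) (hF : F ∈ 𝓘) (hn : n ∈ F)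
    (hAB : ∀ AB ∈ newp n 𝔛, AB.2.card < AB.1.card) (ρ : Finset ℕ × Finset ℕ → ℚ) (d q : ℚ) :
    ev (newpF n 𝔛) ρ d (kv n q 𝓘 F) = ∑ A ∈ 𝓘.erase F,
      d ^ (A.card - (F.erase n).card) * q ^ (A.card - (F.erase n).card - 1) *
        ρ (A, F.erase n) := by
  classical
  have hsub : (𝓘.erase F).image (fun A => (A, F.erase n)) ⊆ newpF n 𝔛 := by
    intro z hz
    obtain ⟨A, hA, rfl⟩ := Finset.mem_image.1 hz
    exact (mem_newpF_iff _ _ _).2 (pair_mem hI h𝓘 hF hn hA).1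
  rw [ev, ← Finset.sum_subset hsub, Finset.sum_image]
  · refine Finset.sum_congr rfl fun A hA => ?_
    congr 1
    have hlt := hAB _ (pair_mem hI h𝓘 hF hn hA).1
    simp only at hlt
    have hle : A.card ≤ n := by
      have := Finset.card_le_card (hI.2.1 A (Finset.mem_erase.1 hA).2).2
      simpa using this
    rw [Finset.sum_eq_single ⟨A.card - (F.erase n).card - 1, by omega⟩]
    · have h1 : A.card - (F.erase n).card - 1 + 1 = A.card - (F.erase n).card := by omega
      rw [kv, if_pos ⟨hA, rfl, by simp only; omega⟩]
      simp only [h1]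
    · intro m _ hm
      rw [kv, if_neg, mul_zero]
      rintro ⟨-, -, h⟩
      simp only at h
      apply hm
      ext
      simp only
      omega
    · simp
  · intro A _ A' _ h
    exact (Prod.mk.inj h).1
  · intro z _ hz
    rw [Finset.sum_eq_zero, zero_mul]
    intro m _
    rw [kv, if_neg, mul_zero]
    rintro ⟨h1, h2, -⟩
    exact hz (Finset.mem_image.2 ⟨z.1, h1, by rw [← h2]⟩)

theorem prod_F (hn : n ∈ F) (u : ℕ → ℚ) (d q x' : ℚ) :
    ∏ i ∈ F, q * (if i = n then x' else d * u i) =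
      q ^ ((F.erase n).card + 1) * (∏ i ∈ F.erase n, u i) * (1 * d ^ (F.erase n).card * x') := by
  rw [← Finset.mul_prod_erase F _ hn, if_pos rfl]
  have : ∏ i ∈ F.erase n, q * (if i = n then x' else d * u i) = ∏ i ∈ F.erase n, q * (d * u i) :=
    Finset.prod_congr rfl fun i hi => by rw [if_neg (Finset.mem_erase.1 hi).1]
  rw [this, Finset.prod_mul_distrib, Finset.prod_mul_distrib, Finset.prod_const, Finset.prod_const]
  ring

theorem phi_eq (hI : IsNFamily n 𝓘) (h𝓘 : 𝓘 ∈ 𝔛) (hF : F ∈ 𝓘) (hn : n ∈ F)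
    (hAB : ∀ AB ∈ newp n 𝔛, AB.2.card < AB.1.card) (u : ℕ → ℚ)
    (hu : ∀ i ∈ Finset.Icc 1 (n - 1), 0 < u i) (d q x' : ℚ) :
    phi 𝓘 (fun i => q * (if i = n then x' else d * u i)) =
      q ^ ((F.erase n).card + 1) * (∏ i ∈ F.erase n, u i) *
        (1 * d ^ (F.erase n).card * (x' + ev (newpF n 𝔛) (ratio u) d (kv n q 𝓘 F))) := by
  rw [phi, ← Finset.add_sum_erase 𝓘 _ hF, prod_F hn, ev_kv hI h𝓘 hF hn hAB, mul_add, mul_add]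
  congr 1
  rw [Finset.mul_sum, Finset.mul_sum]
  refine Finset.sum_congr rfl fun A hA => ?_
  obtain ⟨hmem, hnA⟩ := pair_mem hI h𝓘 hF hn hA
  have hlt := hAB _ hmem
  simp only at hlt
  have hB : ∏ i ∈ F.erase n, u i ≠ 0 :=
    Finset.prod_ne_zero_iff.2 fun i hi => (hu i (hmem.2.1 hi)).ne'
  have : ∏ i ∈ A, q * (if i = n then x' else d * u i) = ∏ i ∈ A, q * (d * u i) :=
    Finset.prod_congr rfl fun i hi => by rw [if_neg (show ¬ i = n from fun h => hnA (h ▸ hi))]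
  rw [this, Finset.prod_mul_distrib, Finset.prod_mul_distrib, Finset.prod_const, Finset.prod_const,
    ratio]
  obtain ⟨t, ht⟩ := Nat.exists_eq_add_of_lt hlt
  have h1 : A.card - (F.erase n).card = t + 1 := by omega
  rw [h1, ht, Nat.add_sub_cancel]
  simp only
  field_simp
  ring

end fin

theorem exists_shift {ι : Type} (P : Finset ι) (Λ : Finset (ι → ℚ)) :
    ∃ N : ℚ, ∀ l ∈ Λ, ∀ i ∈ P, 0 ≤ l i + N := by
  refine ⟨∑ l ∈ Λ, ∑ i ∈ P, |l i|, fun l hl i hi => ?_⟩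
  have h1 : |l i| ≤ ∑ i ∈ P, |l i| :=
    Finset.single_le_sum (f := fun i => |l i|) (fun _ _ => abs_nonneg _) hi
  have h3 : ∀ l ∈ Λ, 0 ≤ ∑ i ∈ P, |l i| := fun l _ => Finset.sum_nonneg fun _ _ => abs_nonneg _
  have h2 := Finset.single_le_sum h3 hl
  have := neg_abs_le (l i)
  linarith

end SE

/-- **Stable extension.** Let `𝔛` be a collection of new `n`-families (each
`𝓘 ∈ 𝔛` is an `n`-family with `n ∈ f(𝓘)`) with `|A| > |B|` for every
`(A,B) ∈ newp(𝔛)`.  For every positive integer `r` and finite `Q ⊆ ℚ₊` there are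
finite sets `D ⊆ ℕ`, `Q' ⊆ ℚ₊`, `Λ ⊆ ℚ_{≥0}^{newp(𝔛)}` such that: for every
`u ∈ ℚ₊^{n-1}`, `x ∈ ℚ₊`, and `r`-coloring `C` of `ℚ₊`, there exist `d ∈ D`,
`q' ∈ Q'`, `λ ∈ Λ` so that setting
`x' := q'·(x + Σ_{(A,B) ∈ newp(𝔛)} λ_{(A,B)} (Π_{a∈A} u a)/(Π_{b∈B} u b))` and
`v := (d·u₁, …, d·u_{n-1}, x')`, the vector `q·v` is `𝔛`-consistent w.r.t. `C`
(i.e. `C(φ_𝓘(q·v)) = C(Π_{i ∈ f(𝓘)} q·v i)` for each `𝓘 ∈ 𝔛`) for all `q ∈ Q`. -/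
theorem stable_extension (n : ℕ) (𝔛 : Set (Finset (Finset ℕ)))
    (h𝔛 : ∀ 𝓘 ∈ 𝔛, IsNFamily n 𝓘 ∧ ∀ F, IsLeading 𝓘 F → n ∈ F)
    (hAB : ∀ AB ∈ newp n 𝔛, AB.2.card < AB.1.card)
    (r : ℕ) (hr : 0 < r) (Q : Finset ℚ) (hQ : ∀ q ∈ Q, 0 < q) :
    ∃ (D : Finset ℕ) (Q' : Finset ℚ) (Λ : Finset ((Finset ℕ × Finset ℕ) → ℚ)),
      (∀ d ∈ D, 0 < d) ∧ (∀ q' ∈ Q', 0 < q') ∧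
      (∀ l ∈ Λ, ∀ AB ∈ newp n 𝔛, 0 ≤ l AB) ∧
      ∀ u : ℕ → ℚ, (∀ i ∈ Finset.Icc 1 (n - 1), 0 < u i) →
      ∀ x : ℚ, 0 < x → ∀ C : ℚ → Fin r,
        ∃ d ∈ D, ∃ q' ∈ Q', ∃ l ∈ Λ,
          ∀ x' : ℚ, x' = q' * (x + ∑ AB ∈ newpF n 𝔛, l AB * ratio u AB) →
          ∀ v : ℕ → ℚ, v = (fun i => if i = n then x' else (d : ℚ) * u i) →
          ∀ q ∈ Q, ∀ 𝓘 ∈ 𝔛, ∀ F : Finset ℕ, IsLeading 𝓘 F →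
            C (phi 𝓘 (fun i => q * v i)) = C (∏ i ∈ F, q * v i) := by
  classical
  let J := Q ×ˢ (Finset.Icc 1 (n - 1)).powerset
  let K : Finset ((Finset ℕ × Finset ℕ) × Fin n → ℚ) :=
    (Q ×ˢ ((Finset.Icc 1 n).powerset.powerset ×ˢ (Finset.Icc 1 n).powerset)).image
      (fun z => SE.kv n z.1 z.2.1 z.2.2)
  obtain ⟨D, Q', Λ, hD, hQ', h⟩ := SE.stage (newpF n 𝔛) (J → Fin r) n {1} K
  -- a common shift making all the coefficients nonnegative
  obtain ⟨N, hN⟩ := SE.exists_shift (newpF n 𝔛) Λ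
  refine ⟨D, Q', Λ.image (fun l AB => l AB + N), hD, hQ', ?_, ?_⟩
  · intro l hl AB hm
    obtain ⟨l', hl', rfl⟩ := Finset.mem_image.1 hl
    exact hN l' hl' AB ((SE.mem_newpF_iff _ _ _).2 hm)
  intro u hu x _ C
  obtain ⟨d, hd, q', hq', l, hl, hh⟩ := h (ratio u) (x + ∑ AB ∈ newpF n 𝔛, N * ratio u AB)
    (fun y j => C (j.1.1 ^ (j.1.2.card + 1) * (∏ i ∈ j.1.2, u i) * y))
  refine ⟨d, hd, q', hq', _, Finset.mem_image_of_mem _ hl, ?_⟩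
  rintro x' hx' v rfl q hq 𝓘 h𝓘 F hF
  obtain ⟨hI, hlead⟩ := h𝔛 𝓘 h𝓘
  have hn := hlead F hF
  have hFs := (hI.2.1 F hF.1).2
  have hBs : F.erase n ⊆ Finset.Icc 1 (n - 1) :=
    SE.sub_pred ((Finset.erase_subset _ _).trans hFs) (by simp)
  have hn1 : 1 ≤ n := (Finset.mem_Icc.1 (hFs hn)).1
  have hcard : (F.erase n).card < n := by
    have := Finset.card_le_card hBs
    simp only [Nat.card_Icc] at this
    omega
  have hx'' : x' = q' * (x + ∑ AB ∈ newpF n 𝔛, N * ratio u AB +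
      ∑ AB ∈ newpF n 𝔛, l AB * ratio u AB) := by
    rw [hx', add_assoc, ← Finset.sum_add_distrib]
    congr 2
    exact Finset.sum_congr rfl fun _ _ => by ring
  have hk : SE.kv n q 𝓘 F ∈ K := by
    refine Finset.mem_image.2 ⟨(q, 𝓘, F), ?_, rfl⟩
    simp only [Finset.mem_product, Finset.mem_powerset]
    exact ⟨hq, fun I hi => Finset.mem_powerset.2 (hI.2.1 I hi).2, hFs⟩
  have e := congrFun (hh _ hcard 1 (by simp) _ hk)
    ⟨(q, F.erase n), Finset.mem_product.2 ⟨hq, Finset.mem_powerset.2 hBs⟩⟩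
  rw [← hx''] at e
  rw [SE.phi_eq hI h𝓘 hF.1 hn hAB u hu, SE.prod_F hn]
  exact e
end
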